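/- arXiv:1310.8371 — 3 statements merged into one kernel-verified Lean document; each statement's English description precedes it below -/
import Mathlib

section
/- Let a, b ∈ ℂ with 0 ≤ Re(a) < 1 and b ≠ 1, and let V be a simple highest weight module over the Neveu–Schwarz algebra with highest weight vector u of highest weight (c, h), decomposed as V = ⨁_{n ∈ ℕ} V_{h−n/2} as in the grading assumption. Then for every nonzero submodule W of the reduced shifted module there exists N ∈ (1/2)ℤ such that for every s ∈ (1/2)ℤ with s ≥ N, the image of V ⊗ t^s in the reduced shifted module is contained in W. -/
noncomputable section

open Submodule

/-- The underlying data of a `ℤ/2`-graded complex vector space equipped with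
operators `L m` (`m ∈ ℤ`) and `G k` (`k ∈ ℤ`, where `G k` represents the
operator `G_{k+1/2}` indexed by the half-integer `k + 1/2`). -/
structure PreNSMod where
  carrier : Type
  [acg : AddCommGroup carrier]
  [mod : Module ℂ carrier]
  even : Submodule ℂ carrier
  odd : Submodule ℂ carrier
  compl : IsCompl even odd
  L : ℤ → carrier →ₗ[ℂ] carrier
  G : ℤ → carrier →ₗ[ℂ] carrier

attribute [instance] PreNSMod.acg PreNSMod.mod

/-- A Neveu–Schwarz module of central charge `c`. -/
structure NSMod (c : ℂ) extends PreNSMod where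
  mapsL_even : ∀ (m : ℤ), ∀ v ∈ even, L m v ∈ even
  mapsL_odd : ∀ (m : ℤ), ∀ v ∈ odd, L m v ∈ odd
  mapsG_even : ∀ (k : ℤ), ∀ v ∈ even, G k v ∈ odd
  mapsG_odd : ∀ (k : ℤ), ∀ v ∈ odd, G k v ∈ even
  rel_LL : ∀ (m n : ℤ) (v : carrier),
    L m (L n v) - L n (L m v)
      = ((n : ℂ) - (m : ℂ)) • L (m + n) v
        + (if m + n = 0 then (((m : ℂ) ^ 3 - (m : ℂ)) / 12) * c else 0) • v
  rel_LG : ∀ (m k : ℤ) (v : carrier),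
    L m (G k v) - G k (L m v) = (((k : ℂ) + 1 / 2) - (m : ℂ) / 2) • G (m + k) v
  rel_GG : ∀ (k l : ℤ) (v : carrier),
    G k (G l v) + G l (G k v)
      = (2 : ℂ) • L (k + l + 1) v
        - (if k + l + 1 = 0 then (1 / 3) * (((k : ℂ) + 1 / 2) ^ 2 - 1 / 4) * c else 0) • v

/-- A submodule (invariant subspace) of a Neveu–Schwarz module. -/
def NSMod.IsSubmodule {c : ℂ} (S : NSMod c) (W : Submodule ℂ S.carrier) : Prop :=
  (∀ (m : ℤ), ∀ v ∈ W, S.L m v ∈ W) ∧ (∀ (k : ℤ), ∀ v ∈ W, S.G k v ∈ W)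

/-- Simplicity (irreducibility) of a Neveu–Schwarz module. -/
def NSMod.IsSimple {c : ℂ} (S : NSMod c) : Prop :=
  (∃ v : S.carrier, v ≠ 0) ∧
    ∀ W : Submodule ℂ S.carrier, S.IsSubmodule W → W = ⊥ ∨ W = ⊤

/-- `W` is a nonzero submodule which is simple as a module (it has no invariant
subspaces other than `⊥` and itself). -/
def NSMod.IsSimpleSubmodule {c : ℂ} (S : NSMod c) (W : Submodule ℂ S.carrier) : Prop :=
  S.IsSubmodule W ∧ W ≠ ⊥ ∧
    ∀ W' : Submodule ℂ S.carrier, S.IsSubmodule W' → W' ≤ W → W' = ⊥ ∨ W' = W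

/-- A homomorphism of Neveu–Schwarz modules: a linear map commuting with all
the operators `L m` and `G k`. -/
structure NSHom {c c' : ℂ} (S : NSMod c) (T : NSMod c') where
  toFun : S.carrier →ₗ[ℂ] T.carrier
  commL : ∀ (m : ℤ) (v : S.carrier), toFun (S.L m v) = T.L m (toFun v)
  commG : ∀ (k : ℤ) (v : S.carrier), toFun (S.G k v) = T.G k (toFun v)

/-- Two Neveu–Schwarz modules are isomorphic if there is a bijective
homomorphism between them. -/
def NSIso {c c' : ℂ} (S : NSMod c) (T : NSMod c') : Prop :=
  ∃ f : NSHom S T, Function.Bijective f.toFun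

/-- A realization of the intermediate series module `SA_{a,b}` inside a
Neveu–Schwarz module `S` of central charge `0`: a basis `x j` (`j ∈ ℤ`, even)
and `y j` (`j ∈ ℤ`, representing `y_{j+1/2}`, odd) on which the operators act
by the defining formulas of `SA_{a,b}`. -/
structure SAFamily (a b : ℂ) (S : NSMod 0) where
  x : ℤ → S.carrier
  y : ℤ → S.carrier
  x_even : ∀ j : ℤ, x j ∈ S.even
  y_odd : ∀ j : ℤ, y j ∈ S.odd
  indep : LinearIndependent ℂ (Sum.elim x y)
  spans : Submodule.span ℂ (Set.range x ∪ Set.range y) = ⊤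
  act_Lx : ∀ i j : ℤ, S.L i (x j) = (a + (j : ℂ) + (i : ℂ) * b) • x (i + j)
  act_Ly : ∀ i j : ℤ,
    S.L i (y j) = (a + 1 / 2 + (j : ℂ) + (i : ℂ) * (b - 1 / 2)) • y (i + j)
  act_Gx : ∀ i j : ℤ, S.G i (x j) = y (i + j)
  act_Gy : ∀ i j : ℤ,
    S.G i (y j) = (a + 1 / 2 + (j : ℂ) + (2 * (i : ℂ) + 1) * (b - 1 / 2)) • x (i + j + 1)

/-- A realization of the intermediate series module `SA'_{a,b}` (for
`0 ≤ Re a < 1`, `b ≠ 1`) inside a Neveu–Schwarz module `S` of central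
charge `0`.  For `(a,b) ≠ (1/2,1/2)` this is `SA_{a,b}` itself; for
`(a,b) = (1/2,1/2)` it is the quotient `SA_{1/2,1/2}/ℂ·y_{-1/2}`, in which
the image of `y_{-1/2}` (here `y (-1)`) is zero and the remaining vectors
form a basis.  The action formulas hold verbatim in both cases. -/
structure SA'Family (a b : ℂ) (S : NSMod 0) where
  x : ℤ → S.carrier
  y : ℤ → S.carrier
  x_even : ∀ j : ℤ, x j ∈ S.even
  y_odd : ∀ j : ℤ, y j ∈ S.odd
  spans : Submodule.span ℂ (Set.range x ∪ Set.range y) = ⊤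
  indep_special : a = 1 / 2 ∧ b = 1 / 2 →
    y (-1) = 0 ∧
      LinearIndependent ℂ (Sum.elim x (fun j : {j : ℤ // j ≠ -1} => y j.1))
  indep_generic : ¬(a = 1 / 2 ∧ b = 1 / 2) → LinearIndependent ℂ (Sum.elim x y)
  act_Lx : ∀ i j : ℤ, S.L i (x j) = (a + (j : ℂ) + (i : ℂ) * b) • x (i + j)
  act_Ly : ∀ i j : ℤ,
    S.L i (y j) = (a + 1 / 2 + (j : ℂ) + (i : ℂ) * (b - 1 / 2)) • y (i + j)
  act_Gx : ∀ i j : ℤ, S.G i (x j) = y (i + j)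
  act_Gy : ∀ i j : ℤ,
    S.G i (y j) = (a + 1 / 2 + (j : ℂ) + (2 * (i : ℂ) + 1) * (b - 1 / 2)) • x (i + j + 1)

/-- `u` is a highest weight vector of weight `(c,h)` generating the
Neveu–Schwarz module `S` (of central charge `c`). -/
structure IsHW {c : ℂ} (h : ℂ) (S : NSMod c) (u : S.carrier) : Prop where
  ne_zero : u ≠ 0
  mem_even : u ∈ S.even
  hw0 : S.L 0 u = h • u
  hwL : ∀ n : ℤ, 1 ≤ n → S.L n u = 0
  hwG : ∀ k : ℤ, 0 ≤ k → S.G k u = 0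
  gen : ∀ W : Submodule ℂ S.carrier, S.IsSubmodule W → u ∈ W → W = ⊤

/-- A realization of the tensor product Neveu–Schwarz module `V ⊗ S` (with
`V` of central charge `c` and `S` of central charge `0`) as a Neveu–Schwarz
module `T` of central charge `c`, via the bilinear map `t`. -/
structure TensorWitness {c : ℂ} (V : NSMod c) (S : NSMod 0) (T : NSMod c) where
  t : V.carrier →ₗ[ℂ] S.carrier →ₗ[ℂ] T.carrier
  isTensor : IsTensorProduct t
  grade_ee : ∀ v ∈ V.even, ∀ w ∈ S.even, t v w ∈ T.even
  grade_oo : ∀ v ∈ V.odd, ∀ w ∈ S.odd, t v w ∈ T.even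
  grade_eo : ∀ v ∈ V.even, ∀ w ∈ S.odd, t v w ∈ T.odd
  grade_oe : ∀ v ∈ V.odd, ∀ w ∈ S.even, t v w ∈ T.odd
  actL : ∀ (m : ℤ) (v : V.carrier) (w : S.carrier),
    T.L m (t v w) = t (V.L m v) w + t v (S.L m w)
  actG_even : ∀ (k : ℤ), ∀ v ∈ V.even, ∀ w : S.carrier,
    T.G k (t v w) = t (V.G k v) w + t v (S.G k w)
  actG_odd : ∀ (k : ℤ), ∀ v ∈ V.odd, ∀ w : S.carrier,
    T.G k (t v w) = t (V.G k v) w - t v (S.G k w)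

/-- The PBW monomial `L_{-n₁} ⋯ L_{-n_p} G_{-r₁} ⋯ G_{-r_q} u`, where the
second list records each half-integer `r = k - 1/2` by the integer `k`
(so that `G_{-r}` is the operator `G (-k)`). -/
def vermaMonomial {c : ℂ} (M : NSMod c) (u : M.carrier) (p : List ℤ × List ℤ) :
    M.carrier :=
  (p.1.map fun n => M.L (-n)).foldr (fun f v => f v)
    ((p.2.map fun k => M.G (-k)).foldr (fun f v => f v) u)

/-- The index set for the PBW basis of a Verma module: weakly decreasing lists
of positive integers `n₁ ≥ ⋯ ≥ n_p ≥ 1`, together with strictly decreasing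
lists of positive half-integers `r₁ > ⋯ > r_q > 0` (with `r = k - 1/2`
recorded by the integer `k ≥ 1`). -/
def VermaIndex : Type :=
  {p : List ℤ × List ℤ //
    p.1.Chain' (· ≥ ·) ∧ (∀ n ∈ p.1, 1 ≤ n) ∧
      p.2.Chain' (· > ·) ∧ (∀ k ∈ p.2, 1 ≤ k)}

/-- `M` is the Verma module of highest weight `(c,h)` with highest weight
vector `u`: the PBW monomials in the negative-mode operators applied to `u`
form a basis of `M`. -/
def IsVerma {c : ℂ} (h : ℂ) (M : NSMod c) (u : M.carrier) : Prop :=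
  IsHW h M u ∧
    LinearIndependent ℂ (fun p : VermaIndex => vermaMonomial M u p.1) ∧
    Submodule.span ℂ (Set.range fun p : VermaIndex => vermaMonomial M u p.1) = ⊤

/-- The grading assumption on a highest weight module `V` of highest weight
`(c,h)`: `V = ⨁_{n ∈ ℕ} V_{h-n/2}` where `D n = V_{h-n/2}` is the
`L₀`-eigenspace with eigenvalue `h - n/2`, contained in the even part for
`n` even and the odd part for `n` odd, and `u ∈ D 0`. -/
structure GradedHW {c : ℂ} (h : ℂ) (V : NSMod c) (u : V.carrier)
    (D : ℕ → Submodule ℂ V.carrier) : Prop where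
  hw : IsHW h V u
  u_mem : u ∈ D 0
  internal : DirectSum.IsInternal D
  eig : ∀ (n : ℕ), ∀ v ∈ D n, V.L 0 v = (h - (n : ℂ) / 2) • v
  even_part : ∀ n : ℕ, Even n → D n ≤ V.even
  odd_part : ∀ n : ℕ, Odd n → D n ≤ V.odd

/-- A realization of the shifted module `V ⊗ ℂ[t^{±1/2}]` on the graded
vector space `Sh`.  Here `ι p v` represents `v ⊗ t^{p/2}` (half-integers
`s ∈ (1/2)ℤ` are recorded by integers `p` with `s = p/2`), and `D n` is the
weight space `V_{h - n/2}` (so `d = -n/2`).  The case distinction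
`s + d ∈ ℤ` versus `s + d ∈ ℤ + 1/2` becomes `2 ∣ (p - n)` versus its
negation. -/
structure ShiftedWitness (a b : ℂ) {c : ℂ} (V : NSMod c)
    (D : ℕ → Submodule ℂ V.carrier) (Sh : PreNSMod) where
  ι : ℤ → V.carrier →ₗ[ℂ] Sh.carrier
  directSum : Function.Bijective
    (Finsupp.lsum ℂ ι : (ℤ →₀ V.carrier) →ₗ[ℂ] Sh.carrier)
  grade_even : ∀ p : ℤ, (2 : ℤ) ∣ p → ∀ v : V.carrier, ι p v ∈ Sh.even
  grade_odd : ∀ p : ℤ, ¬(2 : ℤ) ∣ p → ∀ v : V.carrier, ι p v ∈ Sh.odd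
  actL : ∀ (k p : ℤ) (n : ℕ), ∀ v ∈ D n,
    Sh.L k (ι p v) = ι (p + 2 * k) (V.L k v)
      + (if (2 : ℤ) ∣ (p - (n : ℤ))
          then a + (p : ℂ) / 2 + (k : ℂ) * b + (n : ℂ) / 2
          else a + (p : ℂ) / 2 + (k : ℂ) * (b - 1 / 2) + (n : ℂ) / 2) •
            ι (p + 2 * k) v
  actG : ∀ (k p : ℤ) (n : ℕ), ∀ v ∈ D n,
    Sh.G k (ι p v) = ι (p + 2 * k + 1) (V.G k v)
      + ((-1 : ℂ) ^ n *
          (if (2 : ℤ) ∣ (p - (n : ℤ)) then 1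
            else a + (p : ℂ) / 2 + (2 * (k : ℂ) + 1) * (b - 1 / 2) + (n : ℂ) / 2)) •
            ι (p + 2 * k + 1) v

/-- A realization of the *reduced* shifted module: the quotient of the
shifted module `V ⊗ ℂ[t^{±1/2}]` by the copy of `V` spanned by the vectors
`v ⊗ t^{d - 1/2}` (`v ∈ V_{h+d}`) when `(a,b) = (1/2,1/2)`, and the shifted
module itself otherwise. -/
structure RedShiftedWitness (a b : ℂ) {c : ℂ} (V : NSMod c)
    (D : ℕ → Submodule ℂ V.carrier) (R : NSMod c) where
  ι : ℤ → V.carrier →ₗ[ℂ] R.carrier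
  surj : Function.Surjective
    (Finsupp.lsum ℂ ι : (ℤ →₀ V.carrier) →ₗ[ℂ] R.carrier)
  ker_special : a = 1 / 2 ∧ b = 1 / 2 →
    LinearMap.ker (Finsupp.lsum ℂ ι : (ℤ →₀ V.carrier) →ₗ[ℂ] R.carrier)
      = Submodule.span ℂ
          {w : ℤ →₀ V.carrier | ∃ n : ℕ, ∃ v ∈ D n, w = Finsupp.single (-(n : ℤ) - 1) v}
  ker_generic : ¬(a = 1 / 2 ∧ b = 1 / 2) →
    LinearMap.ker (Finsupp.lsum ℂ ι : (ℤ →₀ V.carrier) →ₗ[ℂ] R.carrier) = ⊥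
  grade_even : ∀ p : ℤ, (2 : ℤ) ∣ p → ∀ v : V.carrier, ι p v ∈ R.even
  grade_odd : ∀ p : ℤ, ¬(2 : ℤ) ∣ p → ∀ v : V.carrier, ι p v ∈ R.odd
  actL : ∀ (k p : ℤ) (n : ℕ), ∀ v ∈ D n,
    R.L k (ι p v) = ι (p + 2 * k) (V.L k v)
      + (if (2 : ℤ) ∣ (p - (n : ℤ))
          then a + (p : ℂ) / 2 + (k : ℂ) * b + (n : ℂ) / 2
          else a + (p : ℂ) / 2 + (k : ℂ) * (b - 1 / 2) + (n : ℂ) / 2) •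
            ι (p + 2 * k) v
  actG : ∀ (k p : ℤ) (n : ℕ), ∀ v ∈ D n,
    R.G k (ι p v) = ι (p + 2 * k + 1) (V.G k v)
      + ((-1 : ℂ) ^ n *
          (if (2 : ℤ) ∣ (p - (n : ℤ)) then 1
            else a + (p : ℂ) / 2 + (2 * (k : ℂ) + 1) * (b - 1 / 2) + (n : ℂ) / 2)) •
            ι (p + 2 * k + 1) v

/-- `φ` is a shifted character at level `s = p/2` on the Verma module `M`
with grading `D` and highest weight vector `u`:  `φ u = 1` and `φ` satisfies
the defining recursions on homogeneous vectors (`w ∈ D n` means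
`L₀ w = (h + d) w` with `d = -n/2` and `w` of parity `n mod 2`; the operator
`G (-j)` is `G_{-r}` with `r = j - 1/2 > 0`). -/
def IsShiftedChar (a b : ℂ) {c : ℂ} (M : NSMod c)
    (D : ℕ → Submodule ℂ M.carrier) (u : M.carrier) (p : ℤ)
    (φ : M.carrier →ₗ[ℂ] ℂ) : Prop :=
  φ u = 1 ∧
    (∀ (n : ℕ), ∀ w ∈ D n, ∀ k : ℤ, 1 ≤ k →
      φ (M.L (-k) w)
        = (if (2 : ℤ) ∣ (p - (n : ℤ))
            then -(a + (p : ℂ) / 2 + (k : ℂ) - (k : ℂ) * b + (n : ℂ) / 2)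
            else -(a + (p : ℂ) / 2 + (k : ℂ) - (k : ℂ) * (b - 1 / 2) + (n : ℂ) / 2))
          * φ w) ∧
    (∀ (n : ℕ), ∀ w ∈ D n, ∀ j : ℤ, 1 ≤ j →
      φ (M.G (-j) w)
        = (if (2 : ℤ) ∣ (p - (n : ℤ))
            then -(-1 : ℂ) ^ n *
              (a + (p : ℂ) / 2 + ((j : ℂ) - 1 / 2)
                - 2 * ((j : ℂ) - 1 / 2) * (b - 1 / 2) + (n : ℂ) / 2)
            else -(-1 : ℂ) ^ n)
          * φ w)

/-- If a finite sum of eigenvectors with distinct eigenvalues lies in an invariant subspace, then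
so does each summand. -/
lemma mem_of_sum_eigenvectors_mem {ι E : Type*} [AddCommGroup E] [Module ℂ E]
    (T : E →ₗ[ℂ] E) (W : Submodule ℂ E) (hW : ∀ v ∈ W, T v ∈ W) (μ : ι → ℂ)
    (hμ : Function.Injective μ) (s : Finset ι) :
    ∀ x : ι → E, (∀ i ∈ s, T (x i) = μ i • x i) → ∑ i ∈ s, x i ∈ W → ∀ i ∈ s, x i ∈ W := by
  classical
  induction s using Finset.induction_on with
  | empty => simp
  | insert j s hj ih =>
    intro x hx hsum
    have key : ∀ i ∈ s, (μ i - μ j) • x i ∈ W := by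
      refine ih (fun i => (μ i - μ j) • x i) ?_ ?_
      · intro i hi
        simp only [map_smul, hx i (Finset.mem_insert_of_mem hi)]
        rw [smul_comm]
      · have h1 := W.sub_mem (hW _ hsum) (W.smul_mem (μ j) hsum)
        rw [map_sum, Finset.smul_sum, ← Finset.sum_sub_distrib, Finset.sum_insert hj,
          hx j (Finset.mem_insert_self _ _), sub_self, zero_add] at h1
        convert h1 using 1
        refine Finset.sum_congr rfl fun i hi => ?_
        rw [hx i (Finset.mem_insert_of_mem hi), sub_smul]
    have hs : ∀ i ∈ s, x i ∈ W := by
      intro i hi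
      have hne : μ i - μ j ≠ 0 := sub_ne_zero.2 fun e => hj (hμ e ▸ hi)
      exact (W.smul_mem_iff hne).1 (key i hi)
    intro i hi
    rcases Finset.mem_insert.1 hi with rfl | hi
    · rw [Finset.sum_insert hj] at hsum
      exact (W.add_mem_iff_left (W.sum_mem hs)).1 hsum
    · exact hs i hi

section HighestWeight

variable {c h : ℂ} {V : NSMod c} {u : V.carrier} {D : ℕ → Submodule ℂ V.carrier}

lemma NSMod.isSubmodule_of_G {S : NSMod c} {W : Submodule ℂ S.carrier}
    (hG : ∀ k : ℤ, ∀ v ∈ W, S.G k v ∈ W) : S.IsSubmodule W := by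
  refine ⟨fun m v hv => ?_, hG⟩
  have h1 := S.rel_GG (m - 1) 0 v
  have h2 : (2 : ℂ) • S.L (m - 1 + 0 + 1) v ∈ W := by
    rw [← sub_add_cancel ((2 : ℂ) • S.L (m - 1 + 0 + 1) v), ← h1]
    exact W.add_mem (W.add_mem (hG _ _ (hG _ _ hv)) (hG _ _ (hG _ _ hv))) (W.smul_mem _ hv)
  rw [show m - 1 + 0 + 1 = m by ring] at h2
  exact (W.smul_mem_iff two_ne_zero).1 h2

/-- A highest weight module is generated from its highest weight vector by the operators `G_{-r}`
with `r > 0`. -/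
lemma IsHW.eq_top_of_G_neg (hu : IsHW h V u) (T : Submodule ℂ V.carrier) (huT : u ∈ T)
    (hT : ∀ k : ℤ, k < 0 → ∀ v ∈ T, V.G k v ∈ T) : T = ⊤ := by
  set Q : Set (Submodule ℂ V.carrier) :=
    {S | u ∈ S ∧ ∀ k : ℤ, k < 0 → ∀ v ∈ S, V.G k v ∈ S} with hQ
  set S := sInf Q with hS
  have huS : u ∈ S := Submodule.mem_sInf.2 fun A hA => hA.1
  have hSG : ∀ k : ℤ, k < 0 → ∀ v ∈ S, V.G k v ∈ S := fun k hk v hv =>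
    Submodule.mem_sInf.2 fun A hA => hA.2 k hk v (Submodule.mem_sInf.1 hv A hA)
  have hSL : ∀ m : ℤ, m < 0 → ∀ v ∈ S, V.L m v ∈ S := by
    intro m hm v hv
    have h1 := V.rel_GG m (-1) v
    rw [if_neg (by lia), zero_smul, sub_zero, show m + -1 + 1 = m by ring] at h1
    refine (S.smul_mem_iff (two_ne_zero (α := ℂ))).1 ?_
    rw [← h1]
    exact S.add_mem (hSG _ hm _ (hSG _ (by lia) _ hv)) (hSG _ (by lia) _ (hSG _ hm _ hv))
  let A : Submodule ℂ V.carrier :=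
    S ⊓ ((⨅ m : ℤ, S.comap (V.L m)) ⊓ ⨅ k : ℤ, S.comap (V.G k))
  have memA : ∀ v, v ∈ A ↔ v ∈ S ∧ (∀ m : ℤ, V.L m v ∈ S) ∧ ∀ k : ℤ, V.G k v ∈ S := by
    intro v
    simp [A, Submodule.mem_iInf]
  have hA : A ∈ Q := by
    refine ⟨(memA u).2 ⟨huS, fun m => ?_, fun k => ?_⟩, fun k hk v hv => ?_⟩
    · rcases lt_trichotomy m 0 with hm | rfl | hm
      · exact hSL m hm u huS
      · rw [hu.hw0]; exact S.smul_mem _ huS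
      · rw [hu.hwL m (by lia)]; exact S.zero_mem
    · rcases lt_or_ge k 0 with hk | hk
      · exact hSG k hk u huS
      · rw [hu.hwG k hk]; exact S.zero_mem
    · obtain ⟨h1, h2, h3⟩ := (memA v).1 hv
      refine (memA _).2 ⟨h3 k, fun m => ?_, fun l => ?_⟩
      · rw [sub_eq_iff_eq_add.1 (V.rel_LG m k v)]
        exact S.add_mem (S.smul_mem _ (h3 _)) (hSG k hk _ (h2 m))
      · rw [eq_sub_of_add_eq (V.rel_GG l k v)]
        exact S.sub_mem (S.sub_mem (S.smul_mem _ (h2 _)) (S.smul_mem _ h1)) (hSG k hk _ (h3 l))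
  have hSA : S ≤ A := sInf_le hA
  have htop : S = ⊤ := hu.gen S
    ⟨fun m v hv => ((memA v).1 (hSA hv)).2.1 m, fun k v hv => ((memA v).1 (hSA hv)).2.2 k⟩ huS
  exact top_le_iff.1 (htop ▸ sInf_le ⟨huT, hT⟩)

lemma GradedHW.exists_sum (hV : GradedHW h V u D) (v : V.carrier) :
    ∃ (s : Finset ℕ) (x : ℕ → V.carrier), (∀ n, x n ∈ D n) ∧ v = ∑ n ∈ s, x n := by
  have hv : v ∈ ⨆ n, D n := by rw [hV.internal.submodule_iSup_eq_top]; trivial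
  obtain ⟨f, hf, rfl⟩ := (Submodule.mem_iSup_iff_exists_finsupp D v).1 hv
  exact ⟨f.support, f, hf, rfl⟩

lemma weight_injective (h : ℂ) : Function.Injective fun n : ℕ => h - (n : ℂ) / 2 := by
  intro n m e
  simp only [sub_right_inj] at e
  exact_mod_cast (div_left_inj' (two_ne_zero (α := ℂ))).1 e

/-- An `L₀`-eigenvector of weight `h - m/2` is a combination of vectors in `D n` with `n = m`. -/
lemma GradedHW.exists_sum_of_eigenvector (hV : GradedHW h V u D) {w : V.carrier} {m : ℤ}
    (hw : V.L 0 w = (h - (m : ℂ) / 2) • w) :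
    ∃ (s : Finset ℕ) (x : ℕ → V.carrier), (∀ n, x n ∈ D n) ∧ w = ∑ n ∈ s, x n ∧
      ∀ n ∈ s, (n : ℤ) ≠ m → x n = 0 := by
  obtain ⟨s, x, hx, rfl⟩ := hV.exists_sum w
  refine ⟨s, x, hx, rfl, fun n hn hnm => ?_⟩
  have key := mem_of_sum_eigenvectors_mem (V.L 0) ⊥ (by simp) (fun n : ℕ => h - (n : ℂ) / 2)
    (weight_injective h) s (fun n => ((h - (n : ℂ) / 2) - (h - (m : ℂ) / 2)) • x n)
    (fun i _ => by simp only [map_smul, hV.eig i _ (hx i)]; rw [smul_comm])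
    (by
      simp only [sub_smul (h - _ : ℂ), Finset.sum_sub_distrib, ← Finset.smul_sum, Submodule.mem_bot]
      rw [← hw, map_sum, sub_eq_zero]
      exact Finset.sum_congr rfl fun i _ => (hV.eig i _ (hx i)).symm) n hn
  simp only [Submodule.mem_bot, smul_eq_zero] at key
  refine key.resolve_left fun e => hnm ?_
  have : (n : ℂ) = (m : ℂ) := by linear_combination (-2 : ℂ) * e
  exact_mod_cast this

lemma GradedHW.mem_of_eigenvector (hV : GradedHW h V u D) {w : V.carrier} {m : ℕ}
    (hw : V.L 0 w = (h - (m : ℂ) / 2) • w) : w ∈ D m := by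
  obtain ⟨s, x, hx, rfl, h0⟩ := hV.exists_sum_of_eigenvector (m := m) (by simpa using hw)
  refine Submodule.sum_mem _ fun n hn => ?_
  by_cases e : n = m
  · exact e ▸ hx n
  · rw [h0 n hn (by exact_mod_cast e)]; exact Submodule.zero_mem _

lemma GradedHW.eq_zero_of_eigenvector (hV : GradedHW h V u D) {w : V.carrier} {m : ℤ} (hm : m < 0)
    (hw : V.L 0 w = (h - (m : ℂ) / 2) • w) : w = 0 := by
  obtain ⟨s, x, hx, rfl, h0⟩ := hV.exists_sum_of_eigenvector hw
  exact Finset.sum_eq_zero fun n hn => h0 n hn (by lia)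

lemma GradedHW.L_zero_G (hV : GradedHW h V u D) {n : ℕ} {v : V.carrier} (hv : v ∈ D n) (k : ℤ) :
    V.L 0 (V.G k v) = (h - ((n - 2 * k - 1 : ℤ) : ℂ) / 2) • V.G k v := by
  rw [sub_eq_iff_eq_add.1 (V.rel_LG 0 k v), hV.eig n v hv, map_smul, zero_add, ← add_smul]
  congr 1
  push_cast
  ring

lemma GradedHW.G_eq_zero (hV : GradedHW h V u D) {n : ℕ} {v : V.carrier} (hv : v ∈ D n) {k : ℤ}
    (hk : (n : ℤ) ≤ k) : V.G k v = 0 :=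
  hV.eq_zero_of_eigenvector (by lia) (hV.L_zero_G hv k)

lemma GradedHW.G_neg_mem (hV : GradedHW h V u D) {n : ℕ} {v : V.carrier} (hv : v ∈ D n) {k : ℤ}
    (hk : k < 0) : V.G k v ∈ D (n - 2 * k - 1).toNat := by
  refine hV.mem_of_eigenvector ?_
  rw [hV.L_zero_G hv k]
  congr 3
  have : (((n - 2 * k - 1).toNat : ℤ)) = n - 2 * k - 1 := Int.toNat_of_nonneg (by lia)
  exact_mod_cast congrArg (Int.cast (R := ℂ)) this.symm

/-- A bound from which on all `G k` kill the weight spaces `D n` with `n ∈ s`. -/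
lemma GradedHW.exists_bound (hV : GradedHW h V u D) (s : Finset ℕ) {x : ℕ → V.carrier}
    (hx : ∀ n, x n ∈ D n) : ∃ M : ℤ, ∀ k, M ≤ k → ∀ n ∈ s, V.G k (x n) = 0 := by
  refine ⟨((s.sup id : ℕ) : ℤ), fun k hk n hn => hV.G_eq_zero (hx n) (le_trans ?_ hk)⟩
  exact_mod_cast Finset.le_sup (f := id) hn

end HighestWeight

namespace RedShiftedWitness

variable {a b c h : ℂ} {V : NSMod c} {u : V.carrier} {D : ℕ → Submodule ℂ V.carrier}
  {R : NSMod c}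

/-- The scalar by which `G k` acts on the second factor of `v ⊗ t^{p/2}` for `v ∈ D n`. -/
def gCoeff (a b : ℂ) (k p : ℤ) (n : ℕ) : ℂ :=
  (-1 : ℂ) ^ n *
    (if (2 : ℤ) ∣ (p - (n : ℤ)) then 1
      else a + (p : ℂ) / 2 + (2 * (k : ℂ) + 1) * (b - 1 / 2) + (n : ℂ) / 2)

lemma gCoeff_mul (a b : ℂ) (k l p : ℤ) (n : ℕ) :
    gCoeff a b l p n * gCoeff a b k (p + 2 * l + 1) n =
      if (2 : ℤ) ∣ (p - (n : ℤ)) then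
        a + (p + 2 * l + 1) / 2 + (2 * (k : ℂ) + 1) * (b - 1 / 2) + (n : ℂ) / 2
      else a + (p : ℂ) / 2 + (2 * (l : ℂ) + 1) * (b - 1 / 2) + (n : ℂ) / 2 := by
  have hs : (-1 : ℂ) ^ n * (-1 : ℂ) ^ n = 1 := by rw [← mul_pow]; simp
  unfold gCoeff
  by_cases hp : (2 : ℤ) ∣ (p - (n : ℤ))
  · rw [if_pos hp, if_pos hp, if_neg (by lia)]
    push_cast
    linear_combination (a + (p + 2 * l + 1) / 2 + (2 * (k : ℂ) + 1) * (b - 1 / 2) + (n : ℂ) / 2) * hs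
  · rw [if_neg hp, if_neg hp, if_pos (by lia)]
    linear_combination (a + (p : ℂ) / 2 + (2 * (l : ℂ) + 1) * (b - 1 / 2) + (n : ℂ) / 2) * hs

lemma G_ι (rsw : RedShiftedWitness a b V D R) (k p : ℤ) {n : ℕ} {v : V.carrier} (hv : v ∈ D n) :
    R.G k (rsw.ι p v) =
      rsw.ι (p + 2 * k + 1) (V.G k v) + gCoeff a b k p n • rsw.ι (p + 2 * k + 1) v :=
  rsw.actG k p n v hv

lemma G_ι_sum (rsw : RedShiftedWitness a b V D R) {s : Finset ℕ} {x : ℕ → V.carrier}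
    (hx : ∀ n, x n ∈ D n) {k : ℤ} (hk : ∀ n ∈ s, V.G k (x n) = 0) (p : ℤ) (f : ℕ → ℂ) :
    R.G k (rsw.ι p (∑ n ∈ s, f n • x n)) =
      rsw.ι (p + 2 * k + 1) (∑ n ∈ s, (f n * gCoeff a b k p n) • x n) := by
  simp only [map_sum, map_smul]
  refine Finset.sum_congr rfl fun n hn => ?_
  rw [rsw.G_ι k p (hx n), hk n hn, map_zero, zero_add, smul_smul]

/-- Two large modes of `G` act diagonally. -/
lemma ι_sum_gCoeff_mul_mem (rsw : RedShiftedWitness a b V D R) {W : Submodule ℂ R.carrier}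
    (hW : R.IsSubmodule W) {s : Finset ℕ} {x : ℕ → V.carrier} (hx : ∀ n, x n ∈ D n) {k l : ℤ}
    (hk : ∀ n ∈ s, V.G k (x n) = 0) (hl : ∀ n ∈ s, V.G l (x n) = 0) {p q : ℤ}
    (hq : q = p + 2 * (k + l + 1)) (hp : rsw.ι p (∑ n ∈ s, x n) ∈ W) :
    rsw.ι q (∑ n ∈ s, (gCoeff a b l p n * gCoeff a b k (p + 2 * l + 1) n) • x n) ∈ W := by
  have h1 := hW.2 k _ (hW.2 l _ hp)
  have h2 := rsw.G_ι_sum hx hl p 1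
  simp only [Pi.one_apply, one_smul, one_mul] at h2
  rw [h2, rsw.G_ι_sum hx hk, show p + 2 * l + 1 + 2 * k + 1 = q by rw [hq]; ring] at h1
  exact h1

/-- The vectors `v` such that `v ⊗ t^{q/2}` lies in `W` for all sufficiently large `q ∈ P`. -/
def tail (rsw : RedShiftedWitness a b V D R) (W : Submodule ℂ R.carrier) (P : Set ℤ) :
    Submodule ℂ V.carrier where
  carrier := {v | ∃ N : ℤ, ∀ q, N ≤ q → q ∈ P → rsw.ι q v ∈ W}
  add_mem' := by
    rintro v w ⟨N, hN⟩ ⟨M, hM⟩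
    refine ⟨max N M, fun q hq hP => ?_⟩
    rw [map_add]
    exact W.add_mem (hN q (le_trans (le_max_left _ _) hq) hP)
      (hM q (le_trans (le_max_right _ _) hq) hP)
  zero_mem' := ⟨0, fun q _ _ => by rw [map_zero]; exact W.zero_mem⟩
  smul_mem' := by
    rintro z v ⟨N, hN⟩
    exact ⟨N, fun q hq hP => by rw [map_smul]; exact W.smul_mem _ (hN q hq hP)⟩

lemma mem_tail {rsw : RedShiftedWitness a b V D R} {W : Submodule ℂ R.carrier} {P : Set ℤ}
    {v : V.carrier} : v ∈ rsw.tail W P ↔ ∃ N : ℤ, ∀ q, N ≤ q → q ∈ P → rsw.ι q v ∈ W := Iff.rfl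

lemma L_zero_mem_tail (hV : GradedHW h V u D) (rsw : RedShiftedWitness a b V D R)
    {W : Submodule ℂ R.carrier} (hW : R.IsSubmodule W) {P : Set ℤ}
    (hP : ∀ q ∈ P, ∀ k : ℤ, q - 2 * k ∈ P) {v : V.carrier} (hv : v ∈ rsw.tail W P) :
    V.L 0 v ∈ rsw.tail W P := by
  obtain ⟨s, x, hx, rfl⟩ := hV.exists_sum v
  obtain ⟨M, hM⟩ := hV.exists_bound s hx
  obtain ⟨N, hN⟩ := hv
  refine ⟨max N (N + 2 * (2 * M + 2)), fun q hq hqP => ?_⟩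
  have hv := hN q (le_trans (le_max_left _ _) hq) hqP
  have hq2 := le_trans (le_max_right _ _) hq
  have key : ∀ k l : ℤ, M ≤ k → M ≤ l → k + l ≤ 2 * M + 1 →
      rsw.ι q (∑ n ∈ s, (gCoeff a b l (q - 2 * (k + l + 1)) n *
        gCoeff a b k (q - 2 * (k + l + 1) + 2 * l + 1) n) • x n) ∈ W := fun k l hk hl hkl =>
    rsw.ι_sum_gCoeff_mul_mem hW hx (hM k hk) (hM l hl) (by ring)
      (hN _ (by lia) (hP q hqP _))
  have k00 := key M M le_rfl le_rfl (by lia)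
  have k10 := key (M + 1) M (by lia) le_rfl (by lia)
  have k01 := key M (M + 1) le_rfl (by lia) (by lia)
  set z : ℂ := (2 * M + 1) / 2 with hz
  have comb := W.add_mem (W.smul_mem (h + a + q / 2) hv)
    (W.add_mem (W.smul_mem (-(1 + 2 * z)) k00)
      (W.add_mem (W.smul_mem z k10) (W.smul_mem z k01)))
  simp only [gCoeff_mul, ← map_smul, ← map_add, Finset.smul_sum, smul_smul, ← add_smul,
    ← Finset.sum_add_distrib] at comb
  convert comb using 2
  rw [map_sum]
  refine Finset.sum_congr rfl fun n _ => ?_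
  rw [hV.eig n _ (hx n)]
  congr 1
  by_cases hp : (2 : ℤ) ∣ (q - (n : ℤ))
  · rw [if_pos (by lia), if_pos (by lia), if_pos (by lia), hz]
    push_cast
    ring
  · rw [if_neg (by lia), if_neg (by lia), if_neg (by lia), hz]
    push_cast
    ring

lemma mem_tail_of_sum_mem_tail (hV : GradedHW h V u D) (rsw : RedShiftedWitness a b V D R)
    {W : Submodule ℂ R.carrier} (hW : R.IsSubmodule W) {P : Set ℤ}
    (hP : ∀ q ∈ P, ∀ k : ℤ, q - 2 * k ∈ P) {s : Finset ℕ} {x : ℕ → V.carrier}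
    (hx : ∀ n, x n ∈ D n) (hs : ∑ n ∈ s, x n ∈ rsw.tail W P) : ∀ n ∈ s, x n ∈ rsw.tail W P :=
  mem_of_sum_eigenvectors_mem (V.L 0) _ (fun _ hv => rsw.L_zero_mem_tail hV hW hP hv)
    (fun n : ℕ => h - (n : ℂ) / 2) (weight_injective h) s x (fun n _ => hV.eig n _ (hx n)) hs

lemma isSubmodule_tail_univ (hV : GradedHW h V u D) (rsw : RedShiftedWitness a b V D R)
    {W : Submodule ℂ R.carrier} (hW : R.IsSubmodule W) :
    V.IsSubmodule (rsw.tail W Set.univ) := by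
  refine NSMod.isSubmodule_of_G fun k v hv => ?_
  obtain ⟨s, x, hx, rfl⟩ := hV.exists_sum v
  rw [map_sum]
  refine Submodule.sum_mem _ fun n hn => ?_
  obtain ⟨N, hN⟩ := rsw.mem_tail_of_sum_mem_tail hV hW (fun _ _ _ => Set.mem_univ _) hx hv n hn
  refine ⟨max N (N + 2 * k + 1), fun q hq _ => ?_⟩
  have h1 := rsw.G_ι k (q - 2 * k - 1) (hx n)
  rw [show q - 2 * k - 1 + 2 * k + 1 = q by ring] at h1
  rw [← sub_eq_iff_eq_add] at h1
  rw [← h1]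
  exact W.sub_mem (hW.2 _ _ (hN _ (by lia) trivial)) (W.smul_mem _ (hN q (by lia) trivial))

/-- The large modes send `v ⊗ t^{p/2} ∈ W` to multiples of the components of `v`, taken with
all sufficiently large powers of `t` of the same parity. -/
lemma smul_mem_tail_of_sum_mem (hV : GradedHW h V u D) (rsw : RedShiftedWitness a b V D R)
    {W : Submodule ℂ R.carrier} (hW : R.IsSubmodule W) {s : Finset ℕ} {x : ℕ → V.carrier}
    (hx : ∀ n, x n ∈ D n) {p : ℤ} (hs : rsw.ι p (∑ n ∈ s, x n) ∈ W) {n : ℕ} (hn : n ∈ s) :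
    (if (2 : ℤ) ∣ (p - (n : ℤ)) then 1 - 2 * (b - 1 / 2) else 2 * (b - 1 / 2)) • x n ∈
      rsw.tail W {q | (2 : ℤ) ∣ (q - p)} := by
  obtain ⟨M, hM⟩ := hV.exists_bound s hx
  refine rsw.mem_tail_of_sum_mem_tail hV hW (x := fun n => (if (2 : ℤ) ∣ (p - (n : ℤ)) then
    1 - 2 * (b - 1 / 2) else 2 * (b - 1 / 2)) • x n) ?_ (fun n => Submodule.smul_mem _ _ (hx n)) ?_
    n hn
  · intro q hq k
    simp only [Set.mem_ofPred_eq] at hq ⊢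
    lia
  · refine ⟨p + 2 * (2 * M + 2), fun q hq ⟨K, hK⟩ => ?_⟩
    have k0 := rsw.ι_sum_gCoeff_mul_mem hW hx (k := K - 1 - M) (l := M) (q := q)
      (hM _ (by lia)) (hM _ le_rfl) (by lia) hs
    have k1 := rsw.ι_sum_gCoeff_mul_mem hW hx (k := K - 2 - M) (l := M + 1) (q := q)
      (hM _ (by lia)) (hM _ (by lia)) (by lia) hs
    have comb := W.sub_mem k1 k0
    simp only [gCoeff_mul, ← map_sub, ← sub_smul, ← Finset.sum_sub_distrib] at comb
    convert comb using 4 with i hi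
    split_ifs <;> push_cast <;> ring

lemma mem_tail_univ_of_mem_tail (hb : b ≠ 1) (hV : GradedHW h V u D)
    (rsw : RedShiftedWitness a b V D R) {W : Submodule ℂ R.carrier} (hW : R.IsSubmodule W)
    {ε : ℤ} {n : ℕ} {v : V.carrier} (hv : v ∈ D n)
    (ht : v ∈ rsw.tail W {q | (2 : ℤ) ∣ (q - ε)}) : v ∈ rsw.tail W Set.univ := by
  obtain ⟨N, hN⟩ := ht
  simp only [Set.mem_ofPred_eq] at hN
  obtain ⟨p, hNp, hp⟩ : ∃ p, N ≤ p ∧ (2 : ℤ) ∣ (p - ε) := by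
    rcases Int.even_or_odd (N - ε) with hN2 | hN2
    · exact ⟨N, le_rfl, hN2.two_dvd⟩
    · exact ⟨N + 1, by lia, by obtain ⟨r, hr⟩ := hN2; lia⟩
  refine ⟨max N (p + 2 * (n + 2) + 1), fun q hq _ => ?_⟩
  by_cases hqε : (2 : ℤ) ∣ (q - ε)
  · exact hN q (by lia) hqε
  obtain ⟨k, hk⟩ : ∃ k, q = p + 2 * k + 1 := ⟨(q - p - 1) / 2, by lia⟩
  have h1 := hW.2 k _ (hN p hNp hp)
  have h2 := hW.2 (k - 1) _ (hN (p + 2) (by lia) (by lia))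
  rw [rsw.G_ι _ _ hv, hV.G_eq_zero hv (by lia), map_zero, zero_add] at h1 h2
  rw [← hk] at h1
  rw [show p + 2 + 2 * (k - 1) + 1 = q by lia] at h2
  have hs : (-1 : ℂ) ^ n ≠ 0 := pow_ne_zero _ (by norm_num)
  by_cases hpn : (2 : ℤ) ∣ (p - (n : ℤ))
  · rw [gCoeff, if_pos hpn, mul_one] at h1
    exact (W.smul_mem_iff hs).1 h1
  · have h3 := W.sub_mem h2 h1
    rw [← sub_smul, gCoeff, gCoeff, if_neg hpn, if_neg (by lia), ← mul_sub] at h3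
    refine (W.smul_mem_iff (mul_ne_zero hs ?_)).1 h3
    push_cast
    intro e
    exact hb (by linear_combination (-1 / 2 : ℂ) * e)

lemma L_zero_ι (hV : GradedHW h V u D) (rsw : RedShiftedWitness a b V D R) (p : ℤ)
    (v : V.carrier) : R.L 0 (rsw.ι p v) = (h + a + (p : ℂ) / 2) • rsw.ι p v := by
  obtain ⟨s, x, hx, rfl⟩ := hV.exists_sum v
  simp only [map_sum, Finset.smul_sum]
  refine Finset.sum_congr rfl fun n _ => ?_
  rw [rsw.actL 0 p n _ (hx n), hV.eig n _ (hx n), map_smul, mul_zero, add_zero, ← add_smul]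
  congr 1
  split_ifs <;> push_cast <;> ring

/-- A nonzero submodule contains a nonzero vector of the form `v ⊗ t^{p/2}`. -/
lemma exists_ι_mem (hV : GradedHW h V u D) (rsw : RedShiftedWitness a b V D R)
    {W : Submodule ℂ R.carrier} (hW : R.IsSubmodule W) (hne : W ≠ ⊥) :
    ∃ (p : ℤ) (v : V.carrier), rsw.ι p v ∈ W ∧ rsw.ι p v ≠ 0 := by
  obtain ⟨w, hw, hw0⟩ := W.ne_bot_iff.1 hne
  obtain ⟨f, rfl⟩ := rsw.surj w
  rw [Finsupp.lsum_apply, Finsupp.sum] at hw hw0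
  obtain ⟨p, hp, hp0⟩ := Finset.exists_ne_zero_of_sum_ne_zero hw0
  refine ⟨p, f p, ?_, hp0⟩
  refine mem_of_sum_eigenvectors_mem (R.L 0) W (hW.1 0) (fun p : ℤ => h + a + (p : ℂ) / 2) ?_
    f.support (fun p => rsw.ι p (f p)) (fun p _ => rsw.L_zero_ι hV p _) hw p hp
  intro p q e
  simp only [add_right_inj] at e
  exact_mod_cast (div_left_inj' (two_ne_zero (α := ℂ))).1 e

lemma ι_eq_zero_of_special (rsw : RedShiftedWitness a b V D R) (hab : a = 1 / 2 ∧ b = 1 / 2)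
    {p : ℤ} {n : ℕ} (hp : p = -(n : ℤ) - 1) {v : V.carrier} (hv : v ∈ D n) : rsw.ι p v = 0 := by
  have h1 : Finsupp.single p v ∈
      LinearMap.ker (Finsupp.lsum ℂ rsw.ι : (ℤ →₀ V.carrier) →ₗ[ℂ] R.carrier) := by
    rw [rsw.ker_special hab]
    exact Submodule.subset_span ⟨n, v, hv, by rw [hp]⟩
  simpa using h1

/-- Some nonzero homogeneous `v` has `v ⊗ t^{q/2} ∈ W` for all large `q` of one parity. -/
lemma exists_mem_tail (ha0 : 0 ≤ a.re) (ha1 : a.re < 1) (hb : b ≠ 1) (hV : GradedHW h V u D)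
    (rsw : RedShiftedWitness a b V D R) {W : Submodule ℂ R.carrier} (hW : R.IsSubmodule W)
    (hne : W ≠ ⊥) :
    ∃ (ε : ℤ) (n : ℕ) (v : V.carrier), v ≠ 0 ∧ v ∈ D n ∧
      v ∈ rsw.tail W {q | (2 : ℤ) ∣ (q - ε)} := by
  obtain ⟨p, v, hv, hv0⟩ := rsw.exists_ι_mem hV hW hne
  obtain ⟨s, x, hx, rfl⟩ := hV.exists_sum v
  have hb' : 1 - 2 * (b - 1 / 2) ≠ 0 := fun e => hb (by linear_combination (-1 / 2 : ℂ) * e)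
  obtain ⟨n, hn, hn0⟩ := Finset.exists_ne_zero_of_sum_ne_zero (by rwa [map_sum] at hv0)
  have hxn : x n ≠ 0 := fun e => hn0 (by simp only [e, map_zero])
  have h1 := rsw.smul_mem_tail_of_sum_mem hV hW hx hv hn
  by_cases hpn : (2 : ℤ) ∣ (p - (n : ℤ))
  · rw [if_pos hpn] at h1
    exact ⟨p, n, x n, hxn, hx n, (Submodule.smul_mem_iff _ hb').1 h1⟩
  rw [if_neg hpn] at h1
  by_cases hβ : b - 1 / 2 = 0
  · obtain ⟨k, hk⟩ := hV.exists_bound s hx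
    have h2 := hW.2 k _ hv
    have h3 := rsw.G_ι_sum hx (hk k le_rfl) p 1
    simp only [Pi.one_apply, one_smul, one_mul] at h3
    rw [h3] at h2
    have h4 := rsw.smul_mem_tail_of_sum_mem hV hW (fun n => (D n).smul_mem _ (hx n)) h2 hn
    rw [if_pos (by lia), Submodule.smul_mem_iff _ hb', gCoeff, if_neg hpn, hβ, mul_zero,
      add_zero, Submodule.smul_mem_iff] at h4
    · exact ⟨_, n, x n, hxn, hx n, h4⟩
    refine mul_ne_zero (pow_ne_zero _ (by norm_num)) fun e => hn0 ?_
    have ha : a = ((-(p + n : ℤ) : ℝ) / 2 : ℝ) := by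
      push_cast
      linear_combination e
    rw [ha, Complex.ofReal_re] at ha0 ha1
    have hlo : (0 : ℝ) ≤ (-(p + n : ℤ) : ℝ) := by linarith
    have hhi : (-(p + n : ℤ) : ℝ) < 2 := by linarith
    have hlo' : 0 ≤ -(p + n : ℤ) := by exact_mod_cast hlo
    have hhi' : -(p + n : ℤ) < 2 := by exact_mod_cast hhi
    have hp : p = -(n : ℤ) - 1 := by lia
    refine rsw.ι_eq_zero_of_special ⟨?_, by linear_combination hβ⟩ hp (hx n)
    rw [ha, hp]
    push_cast
    ring
  · exact ⟨p, n, x n, hxn, hx n,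
      (Submodule.smul_mem_iff _ (mul_ne_zero two_ne_zero hβ)).1 h1⟩

/-- If `u ⊗ t^{q/2} ∈ W` for all `q ≥ N`, then `W` contains `V ⊗ t^{q/2}` for all `q ≥ N`. -/
lemma ι_mem_of_highestWeight (hV : GradedHW h V u D) (rsw : RedShiftedWitness a b V D R)
    {W : Submodule ℂ R.carrier} (hW : R.IsSubmodule W) {N : ℤ}
    (hN : ∀ q, N ≤ q → rsw.ι q u ∈ W) (q : ℤ) (hq : N ≤ q) (v : V.carrier) :
    rsw.ι q v ∈ W := by
  set U : Submodule ℂ V.carrier := ⨅ q : Set.Ici N, W.comap (rsw.ι q) with hU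
  have memU : ∀ v, v ∈ U ↔ ∀ q, N ≤ q → rsw.ι q v ∈ W := by
    intro v
    simp [hU, Submodule.mem_iInf]
  set T : Submodule ℂ V.carrier := ⨆ n, D n ⊓ U with hT
  have htop : T = ⊤ := by
    refine hV.hw.eq_top_of_G_neg T
      (Submodule.mem_iSup_of_mem 0 ⟨hV.u_mem, (memU u).2 hN⟩) fun k hk v hv => ?_
    suffices T ≤ T.comap (V.G k) from this hv
    refine iSup_le fun n w hw => ?_
    refine Submodule.mem_iSup_of_mem (n - 2 * k - 1).toNat ⟨hV.G_neg_mem hw.1 hk, ?_⟩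
    have hwU := (memU w).1 hw.2
    refine (memU _).2 fun q hq => ?_
    have h1 := rsw.G_ι k (q - 2 * k - 1) hw.1
    rw [show q - 2 * k - 1 + 2 * k + 1 = q by ring, ← sub_eq_iff_eq_add] at h1
    rw [← h1]
    exact W.sub_mem (hW.2 _ _ (hwU _ (by lia))) (W.smul_mem _ (hwU q hq))
  have hTU : T ≤ U := iSup_le fun n => inf_le_right
  exact (memU v).1 (hTU (htop ▸ Submodule.mem_top)) q hq

end RedShiftedWitness


/-- Lemma 3.4: every nonzero submodule `W` of the reduced
shifted module of a simple highest weight module `V` contains the image of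
`V ⊗ t^s` for all sufficiently large `s ∈ (1/2)ℤ` (recorded as `s = p/2`). -/
theorem reduced_shifted_submodule_contains_tail (a b c h : ℂ)
    (ha0 : 0 ≤ a.re) (ha1 : a.re < 1) (hb : b ≠ 1)
    (V : NSMod c) (u : V.carrier) (D : ℕ → Submodule ℂ V.carrier)
    (hV : GradedHW h V u D) (hsimple : V.IsSimple)
    (R : NSMod c) (rsw : RedShiftedWitness a b V D R)
    (W : Submodule ℂ R.carrier) (hW : R.IsSubmodule W) (hne : W ≠ ⊥) :
    ∃ N : ℤ, ∀ p : ℤ, N ≤ p → ∀ v : V.carrier, rsw.ι p v ∈ W := by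
  obtain ⟨ε, n, v, hv0, hvD, hvt⟩ := rsw.exists_mem_tail ha0 ha1 hb hV hW hne
  have hv := rsw.mem_tail_univ_of_mem_tail hb hV hW hvD hvt
  have htop : rsw.tail W Set.univ = ⊤ :=
    (hsimple.2 _ (rsw.isSubmodule_tail_univ hV hW)).resolve_left
      (Submodule.ne_bot_iff _ |>.2 ⟨v, hv, hv0⟩)
  obtain ⟨N, hN⟩ : u ∈ rsw.tail W Set.univ := htop ▸ Submodule.mem_top
  exact ⟨N, rsw.ι_mem_of_highestWeight hV hW fun q hq => hN q hq trivial⟩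
end
end

section
/- Let c, h, a, b, c₁, h₁, a₁, b₁ ∈ ℂ with 0 ≤ Re(a) < 1, 0 ≤ Re(a₁) < 1, b ≠ 1 and b₁ ≠ 1. Let V be a simple highest weight module over the Neveu–Schwarz algebra with highest weight (c, h) and let V₁ be a simple highest weight module with highest weight (c₁, h₁). Then V ⊗ SA'_{a,b} and V₁ ⊗ SA'_{a₁,b₁} are isomorphic as Neveu–Schwarz modules if and only if c = c₁, h = h₁, a = a₁ and b = b₁. -/
noncomputable section

open Submodule

section Words

variable {E : Type} [AddCommGroup E] [Module ℂ E]

/-- The commutation relations of the Neveu–Schwarz algebra at central charge `c`, for operators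
on a vector space without a chosen grading. -/
structure NSRel (c : ℂ) (L G : ℤ → E →ₗ[ℂ] E) : Prop where
  LL : ∀ (m n : ℤ) (v : E), L m (L n v) - L n (L m v)
      = ((n : ℂ) - (m : ℂ)) • L (m + n) v
        + (if m + n = 0 then (((m : ℂ) ^ 3 - (m : ℂ)) / 12) * c else 0) • v
  LG : ∀ (m k : ℤ) (v : E),
    L m (G k v) - G k (L m v) = (((k : ℂ) + 1 / 2) - (m : ℂ) / 2) • G (m + k) v
  GG : ∀ (k l : ℤ) (v : E), G k (G l v) + G l (G k v)
      = (2 : ℂ) • L (k + l + 1) v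
        - (if k + l + 1 = 0 then (1 / 3) * (((k : ℂ) + 1 / 2) ^ 2 - 1 / 4) * c else 0) • v

/-- `NSWord L G u n v` says that `v` is obtained from `u` by applying operators of negative degree,
of total degree `-n/2`. -/
inductive NSWord (L G : ℤ → E →ₗ[ℂ] E) (u : E) : ℕ → E → Prop
  | base : NSWord L G u 0 u
  | applyL (n k : ℕ) (v : E) (hv : NSWord L G u n v) :
      NSWord L G u (n + 2 * (k + 1)) (L (-((k : ℤ) + 1)) v)
  | applyG (n k : ℕ) (v : E) (hv : NSWord L G u n v) :
      NSWord L G u (n + (2 * k + 1)) (G (-((k : ℤ) + 1)) v)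

/-- The span of the vectors obtained from `u` by applying operators of negative degree. -/
def wordSpan (L G : ℤ → E →ₗ[ℂ] E) (u : E) : Submodule ℂ E :=
  Submodule.span ℂ {v | ∃ n, NSWord L G u n v}

variable {L G : ℤ → E →ₗ[ℂ] E} {c h : ℂ} {u : E}

theorem wordSpan_negL (k : ℕ) {v : E} (hv : v ∈ wordSpan L G u) :
    L (-((k : ℤ) + 1)) v ∈ wordSpan L G u := by
  have : wordSpan L G u ≤ (wordSpan L G u).comap (L (-((k : ℤ) + 1))) := by
    refine Submodule.span_le.2 ?_
    rintro w ⟨n, hw⟩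
    exact Submodule.subset_span ⟨_, NSWord.applyL n k w hw⟩
  exact this hv

theorem wordSpan_negG (k : ℕ) {v : E} (hv : v ∈ wordSpan L G u) :
    G (-((k : ℤ) + 1)) v ∈ wordSpan L G u := by
  have : wordSpan L G u ≤ (wordSpan L G u).comap (G (-((k : ℤ) + 1))) := by
    refine Submodule.span_le.2 ?_
    rintro w ⟨n, hw⟩
    exact Submodule.subset_span ⟨_, NSWord.applyG n k w hw⟩
  exact this hv

theorem NSWord.mem_wordSpan {n : ℕ} {v : E} (hv : NSWord L G u n v) : v ∈ wordSpan L G u :=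
  Submodule.subset_span ⟨n, hv⟩

theorem NSWord.apply_mem (hr : NSRel c L G) (h0 : L 0 u = h • u)
    (hL : ∀ n : ℤ, 1 ≤ n → L n u = 0) (hG : ∀ k : ℤ, 0 ≤ k → G k u = 0)
    {n : ℕ} {v : E} (hv : NSWord L G u n v) :
    (∀ m, L m v ∈ wordSpan L G u) ∧ ∀ k, G k v ∈ wordSpan L G u := by
  induction hv with
  | base =>
    have hu : u ∈ wordSpan L G u := NSWord.base.mem_wordSpan
    constructor
    · intro m
      rcases lt_trichotomy m 0 with hm | rfl | hm
      · obtain ⟨k, rfl⟩ : ∃ k : ℕ, m = -((k : ℤ) + 1) := ⟨(-m - 1).toNat, by omega⟩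
        exact wordSpan_negL k hu
      · rw [h0]; exact Submodule.smul_mem _ _ hu
      · rw [hL m hm]; exact Submodule.zero_mem _
    · intro m
      rcases lt_or_ge m 0 with hm | hm
      · obtain ⟨k, rfl⟩ : ∃ k : ℕ, m = -((k : ℤ) + 1) := ⟨(-m - 1).toNat, by omega⟩
        exact wordSpan_negG k hu
      · rw [hG m hm]; exact Submodule.zero_mem _
  | applyL n k v hv ih =>
    constructor
    · intro m
      rw [sub_eq_iff_eq_add.1 (hr.LL m _ v)]
      exact Submodule.add_mem _ (Submodule.add_mem _ (Submodule.smul_mem _ _ (ih.1 _))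
        (Submodule.smul_mem _ _ hv.mem_wordSpan)) (wordSpan_negL k (ih.1 m))
    · intro m
      have e : G m (L (-((k : ℤ) + 1)) v) = L (-((k : ℤ) + 1)) (G m v)
          - (((m : ℂ) + 1 / 2) - ((-((k : ℤ) + 1) : ℤ) : ℂ) / 2) • G (-((k : ℤ) + 1) + m) v := by
        rw [← hr.LG]; abel
      rw [e]
      exact Submodule.sub_mem _ (wordSpan_negL k (ih.2 m)) (Submodule.smul_mem _ _ (ih.2 _))
  | applyG n k v hv ih =>
    constructor
    · intro m
      rw [sub_eq_iff_eq_add.1 (hr.LG m _ v)]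
      exact Submodule.add_mem _ (Submodule.smul_mem _ _ (ih.2 _)) (wordSpan_negG k (ih.1 m))
    · intro m
      rw [eq_sub_iff_add_eq.2 (hr.GG m _ v)]
      exact Submodule.sub_mem _ (Submodule.sub_mem _ (Submodule.smul_mem _ _ (ih.1 _))
        (Submodule.smul_mem _ _ hv.mem_wordSpan)) (wordSpan_negG k (ih.2 m))

theorem wordSpan_invariant (hr : NSRel c L G) (h0 : L 0 u = h • u)
    (hL : ∀ n : ℤ, 1 ≤ n → L n u = 0) (hG : ∀ k : ℤ, 0 ≤ k → G k u = 0) :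
    (∀ m, ∀ v ∈ wordSpan L G u, L m v ∈ wordSpan L G u) ∧
      ∀ k, ∀ v ∈ wordSpan L G u, G k v ∈ wordSpan L G u := by
  constructor
  · intro m v hv
    have : wordSpan L G u ≤ (wordSpan L G u).comap (L m) := by
      refine Submodule.span_le.2 ?_
      rintro w ⟨n, hw⟩
      exact (hw.apply_mem hr h0 hL hG).1 m
    exact this hv
  · intro m v hv
    have : wordSpan L G u ≤ (wordSpan L G u).comap (G m) := by
      refine Submodule.span_le.2 ?_
      rintro w ⟨n, hw⟩
      exact (hw.apply_mem hr h0 hL hG).2 m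
    exact this hv

theorem NSWord.weight (hr : NSRel c L G) (h0 : L 0 u = h • u)
    {n : ℕ} {v : E} (hv : NSWord L G u n v) : L 0 v = (h - (n : ℂ) / 2) • v := by
  induction hv with
  | base => simpa using h0
  | applyL n k v hv ih =>
    rw [sub_eq_iff_eq_add.1 (hr.LL 0 _ v), ih, map_smul, zero_add]
    have : (if -((k : ℤ) + 1) = 0 then ((((0 : ℤ) : ℂ) ^ 3 - ((0 : ℤ) : ℂ)) / 12) * c else 0)
        = 0 := by simp
    rw [this, zero_smul, add_zero, ← add_smul]
    congr 1
    push_cast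
    ring
  | applyG n k v hv ih =>
    rw [sub_eq_iff_eq_add.1 (hr.LG 0 _ v), ih, map_smul, zero_add, ← add_smul]
    congr 1
    push_cast
    ring

theorem NSWord.eq_or_pos {n : ℕ} {v : E} (hv : NSWord L G u n v) : v = u ∨ 0 < n := by
  cases hv with
  | base => exact Or.inl rfl
  | applyL => right; omega
  | applyG => right; omega

theorem wordSpan_eigenvalue (hr : NSRel c L G) (h0 : L 0 u = h • u) {μ : ℂ} {v : E}
    (hv : v ∈ wordSpan L G u) (hv0 : v ≠ 0) (hμ : L 0 v = μ • v) :
    ∃ n : ℕ, μ = h - (n : ℂ) / 2 := by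
  by_contra! hne
  have hle : wordSpan L G u ≤ ⨆ ν, ⨆ (_ : ν ≠ μ), Module.End.eigenspace (L 0) ν := by
    refine Submodule.span_le.2 ?_
    rintro w ⟨n, hw⟩
    exact Submodule.mem_iSup_of_mem (h - (n : ℂ) / 2) (Submodule.mem_iSup_of_mem (hne n).symm
      (Module.End.mem_eigenspace_iff.2 (hw.weight hr h0)))
  exact hv0 (Submodule.disjoint_def.1 (Module.End.eigenspaces_iSupIndep (L 0) μ) v
    (Module.End.mem_eigenspace_iff.2 hμ) (hle hv))

theorem wordSpan_top_weight (hr : NSRel c L G) (h0 : L 0 u = h • u) {v : E}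
    (hv : v ∈ wordSpan L G u) (hμ : L 0 v = h • v) : ∃ t : ℂ, v = t • u := by
  have hle : wordSpan L G u ≤
      Submodule.span ℂ {u} ⊔ ⨆ ν, ⨆ (_ : ν ≠ h), Module.End.eigenspace (L 0) ν := by
    refine Submodule.span_le.2 ?_
    rintro w ⟨n, hw⟩
    rcases hw.eq_or_pos with rfl | hn
    · exact Submodule.mem_sup_left (Submodule.mem_span_singleton_self _)
    · refine Submodule.mem_sup_right (Submodule.mem_iSup_of_mem (h - (n : ℂ) / 2)
        (Submodule.mem_iSup_of_mem ?_ (Module.End.mem_eigenspace_iff.2 (hw.weight hr h0))))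
      simpa using hn.ne'
  obtain ⟨y, hy, r, hr', rfl⟩ := Submodule.mem_sup.1 (hle hv)
  obtain ⟨t, rfl⟩ := Submodule.mem_span_singleton.1 hy
  have hrE : r ∈ Module.End.eigenspace (L 0) h := by
    rw [Module.End.mem_eigenspace_iff]
    simpa [h0, smul_comm t h] using hμ
  have : r = 0 := Submodule.disjoint_def.1 (Module.End.eigenspaces_iSupIndep (L 0) h) r hrE hr'
  exact ⟨t, by simp [this]⟩

end Words

section Modules

variable {c c' : ℂ}

theorem NSMod.rel (V : NSMod c) : NSRel c V.L V.G := ⟨V.rel_LL, V.rel_LG, V.rel_GG⟩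

/-- The parity operator: the identity on the even part and minus the identity on the odd part. -/
def PreNSMod.sgn (V : PreNSMod) : V.carrier →ₗ[ℂ] V.carrier :=
  LinearMap.ofIsCompl V.compl V.even.subtype (-V.odd.subtype)

theorem PreNSMod.sgn_even (V : PreNSMod) {v : V.carrier} (hv : v ∈ V.even) : V.sgn v = v :=
  LinearMap.ofIsCompl_apply_left V.compl (⟨v, hv⟩ : V.even)

theorem PreNSMod.sgn_odd (V : PreNSMod) {v : V.carrier} (hv : v ∈ V.odd) : V.sgn v = -v :=
  LinearMap.ofIsCompl_apply_right V.compl (⟨v, hv⟩ : V.odd)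

theorem PreNSMod.exists_even_add_odd (V : PreNSMod) (v : V.carrier) :
    ∃ e ∈ V.even, ∃ o ∈ V.odd, e + o = v :=
  Submodule.mem_sup.1 (V.compl.sup_eq_top ▸ Submodule.mem_top)

theorem PreNSMod.sgn_sgn (V : PreNSMod) (v : V.carrier) : V.sgn (V.sgn v) = v := by
  obtain ⟨e, he, o, ho, rfl⟩ := V.exists_even_add_odd v
  simp [V.sgn_even he, V.sgn_odd ho]

theorem NSMod.sgn_L (V : NSMod c) (m : ℤ) (v : V.carrier) : V.sgn (V.L m v) = V.L m (V.sgn v) := by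
  obtain ⟨e, he, o, ho, rfl⟩ := V.exists_even_add_odd v
  simp [V.sgn_even he, V.sgn_odd ho, V.sgn_even (V.mapsL_even m e he),
    V.sgn_odd (V.mapsL_odd m o ho)]

theorem NSMod.sgn_G (V : NSMod c) (k : ℤ) (v : V.carrier) :
    V.sgn (V.G k v) = -V.G k (V.sgn v) := by
  obtain ⟨e, he, o, ho, rfl⟩ := V.exists_even_add_odd v
  simp [V.sgn_even he, V.sgn_odd ho, V.sgn_odd (V.mapsG_even k e he),
    V.sgn_even (V.mapsG_odd k o ho), add_comm]

/-- The vectors annihilated by all `L i` and `G i` with `i ≥ N`. -/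
def NSMod.tail (V : NSMod c) (N : ℤ) : Submodule ℂ V.carrier where
  carrier := {v | ∀ i, N ≤ i → V.L i v = 0 ∧ V.G i v = 0}
  add_mem' hv hw i hi := by simp [hv i hi, hw i hi]
  zero_mem' i _ := by simp
  smul_mem' t v hv i hi := by simp [hv i hi]

theorem NSMod.tail_mono (V : NSMod c) {M N : ℤ} (h : M ≤ N) : V.tail M ≤ V.tail N :=
  fun _ hv i hi => hv i (h.trans hi)

theorem NSMod.sgn_mem_tail (V : NSMod c) {N : ℤ} {v : V.carrier} (hv : v ∈ V.tail N) :
    V.sgn v ∈ V.tail N := fun i hi =>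
  ⟨by rw [← V.sgn_L, (hv i hi).1, map_zero],
    by rw [← neg_eq_zero, ← V.sgn_G, (hv i hi).2, map_zero]⟩

theorem NSMod.L_mem_tail (V : NSMod c) {N : ℤ} {v : V.carrier} (hv : v ∈ V.tail N) (m : ℤ) :
    V.L m v ∈ V.tail (|N| + |m| + 1) := by
  intro i hi
  have h1 := neg_abs_le m
  have h2 := le_abs_self N
  have h3 := abs_nonneg m
  have h4 := abs_nonneg N
  refine ⟨?_, ?_⟩
  · rw [sub_eq_iff_eq_add.1 (V.rel_LL i m v), (hv i (by omega)).1, (hv (i + m) (by omega)).1,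
      if_neg (by omega)]
    simp
  · have := V.rel_LG m i v
    rw [(hv i (by omega)).2, (hv (m + i) (by omega)).2] at this
    simpa using this

theorem NSMod.G_mem_tail (V : NSMod c) {N : ℤ} {v : V.carrier} (hv : v ∈ V.tail N) (k : ℤ) :
    V.G k v ∈ V.tail (|N| + |k| + 1) := by
  intro i hi
  have h1 := neg_abs_le k
  have h2 := le_abs_self N
  have h3 := abs_nonneg k
  have h4 := abs_nonneg N
  refine ⟨?_, ?_⟩
  · rw [sub_eq_iff_eq_add.1 (V.rel_LG i k v), (hv i (by omega)).1, (hv (i + k) (by omega)).2]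
    simp
  · rw [eq_sub_iff_add_eq.2 (V.rel_GG i k v), (hv i (by omega)).2, (hv (i + k + 1) (by omega)).1,
      if_neg (by omega)]
    simp

theorem IsHW.exists_mem_tail {h : ℂ} {V : NSMod c} {u : V.carrier} (hV : IsHW h V u)
    (v : V.carrier) : ∃ N, v ∈ V.tail N := by
  have hdir : Directed (· ≤ ·) V.tail := directed_of_isDirected_le fun _ _ h => V.tail_mono h
  have key : (⨆ N, V.tail N) = ⊤ := by
    refine hV.gen _ ⟨fun m v hv => ?_, fun k v hv => ?_⟩ ?_
    · obtain ⟨N, hN⟩ := (Submodule.mem_iSup_of_directed _ hdir).1 hv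
      exact Submodule.mem_iSup_of_mem _ (V.L_mem_tail hN m)
    · obtain ⟨N, hN⟩ := (Submodule.mem_iSup_of_directed _ hdir).1 hv
      exact Submodule.mem_iSup_of_mem _ (V.G_mem_tail hN k)
    · exact Submodule.mem_iSup_of_mem 1 fun i hi => ⟨hV.hwL i hi, hV.hwG i (by omega)⟩
  exact (Submodule.mem_iSup_of_directed _ hdir).1 (key ▸ Submodule.mem_top)

/-- In a simple module, the weight of a vector annihilated by all operators of positive degree
dominates the weight of every `L 0`-eigenvector. -/
theorem NSMod.IsSimple.exists_weight_eq {V : NSMod c} (hs : V.IsSimple) {h μ : ℂ}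
    {u w : V.carrier} (hu : u ≠ 0) (h0 : V.L 0 u = h • u)
    (hL : ∀ n : ℤ, 1 ≤ n → V.L n u = 0) (hG : ∀ k : ℤ, 0 ≤ k → V.G k u = 0)
    (hw : w ≠ 0) (hμ : V.L 0 w = μ • w) : ∃ n : ℕ, μ = h - (n : ℂ) / 2 := by
  have htop : wordSpan V.L V.G u = ⊤ := by
    refine (hs.2 _ (wordSpan_invariant V.rel h0 hL hG)).resolve_left fun hbot => hu ?_
    have : u ∈ wordSpan V.L V.G u := NSWord.base.mem_wordSpan
    rwa [hbot, Submodule.mem_bot] at this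
  exact wordSpan_eigenvalue V.rel h0 (htop ▸ Submodule.mem_top) hw hμ

/-- A nonzero map between simple highest weight modules that commutes with all operators
forces the central charges and highest weights to agree. -/
theorem IsHW.eq_of_injective {h h' : ℂ} {V : NSMod c} {V' : NSMod c'} {u : V.carrier}
    {u' : V'.carrier} (hV : IsHW h V u) (hV' : IsHW h' V' u') (hs' : V'.IsSimple)
    (g : NSHom V V') (hg : Function.Injective g.toFun) : c = c' ∧ h = h' := by
  have hgu : g.toFun u ≠ 0 := fun h0 => hV.ne_zero (hg (by rw [h0, map_zero]))
  have hgu0 : V'.L 0 (g.toFun u) = h • g.toFun u := by rw [← g.commL, hV.hw0, map_smul]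
  constructor
  · have e1 := congrArg g.toFun (V.rel_LL 2 (-2) u)
    have e2 := V'.rel_LL 2 (-2) (g.toFun u)
    simp only [map_sub, map_add, map_smul, g.commL] at e1
    have e3 := add_left_cancel (e1.symm.trans e2)
    have e4 := smul_left_injective ℂ hgu e3
    norm_num at e4
    exact e4
  · obtain ⟨n, hn⟩ := hs'.exists_weight_eq hV'.ne_zero hV'.hw0 hV'.hwL hV'.hwG hgu hgu0
    obtain ⟨m, hm⟩ := hs'.exists_weight_eq hgu hgu0
      (fun n hn => by rw [← g.commL, hV.hwL n hn, map_zero])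
      (fun k hk => by rw [← g.commG, hV.hwG k hk, map_zero]) hV'.ne_zero hV'.hw0
    have hnm : ((n + m : ℕ) : ℂ) = 0 := by
      push_cast
      linear_combination 2 * hn + 2 * hm
    have : n = 0 := by
      have := Nat.cast_eq_zero.1 hnm
      omega
    simpa [this] using hn

theorem IsHW.hom_ext {h : ℂ} {V : NSMod c} {V' : NSMod c'} {u : V.carrier} (hV : IsHW h V u)
    (f g : NSHom V V') (hfg : f.toFun u = g.toFun u) : f.toFun = g.toFun := by
  refine LinearMap.eqLocus_eq_top.1 (hV.gen _ ⟨fun m v hv => ?_, fun k v hv => ?_⟩ hfg)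
  · rw [LinearMap.mem_eqLocus] at hv ⊢
    rw [f.commL, g.commL, hv]
  · rw [LinearMap.mem_eqLocus] at hv ⊢
    rw [f.commG, g.commG, hv]

theorem NSMod.rel_prod (V V' : NSMod c) :
    NSRel c (fun m => (V.L m).prodMap (V'.L m)) (fun k => (V.G k).prodMap (V'.G k)) where
  LL m n v := Prod.ext (V.rel_LL m n v.1) (V'.rel_LL m n v.2)
  LG m k v := Prod.ext (V.rel_LG m k v.1) (V'.rel_LG m k v.2)
  GG k l v := Prod.ext (V.rel_GG k l v.1) (V'.rel_GG k l v.2)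

theorem IsHW.exists_hom {h : ℂ} {V V' : NSMod c} {u : V.carrier} {u' : V'.carrier}
    (hV : IsHW h V u) (hV' : IsHW h V' u') (hs' : V'.IsSimple) :
    ∃ g : NSHom V V', g.toFun u = u' := by
  let L : ℤ → (V.carrier × V'.carrier) →ₗ[ℂ] (V.carrier × V'.carrier) :=
    fun m => (V.L m).prodMap (V'.L m)
  let G : ℤ → (V.carrier × V'.carrier) →ₗ[ℂ] (V.carrier × V'.carrier) :=
    fun k => (V.G k).prodMap (V'.G k)
  have hr : NSRel c L G := V.rel_prod V'
  have h0 : L 0 (u, u') = h • (u, u') := Prod.ext hV.hw0 hV'.hw0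
  have hinv := wordSpan_invariant hr h0
    (fun n hn => Prod.ext (hV.hwL n hn) (hV'.hwL n hn))
    (fun k hk => Prod.ext (hV.hwG k hk) (hV'.hwG k hk))
  set N := wordSpan L G (u, u') with hN
  have huN : (u, u') ∈ N := NSWord.base.mem_wordSpan
  have hfib : N.comap (LinearMap.inr ℂ V.carrier V'.carrier) = ⊥ := by
    refine (hs'.2 _ ⟨fun m v hv => ?_, fun k v hv => ?_⟩).resolve_right fun htop => ?_
    · simpa [L] using hinv.1 m _ hv
    · simpa [G] using hinv.2 k _ hv
    · have hmem : ((0 : V.carrier), u') ∈ N := by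
        have : u' ∈ N.comap (LinearMap.inr ℂ V.carrier V'.carrier) := htop ▸ Submodule.mem_top
        exact this
      obtain ⟨t, ht⟩ := wordSpan_top_weight hr h0 hmem
        (Prod.ext (by simp [L]) (by simp [L, hV'.hw0]))
      have ht1 : t = 0 := by
        simpa [hV.ne_zero, eq_comm] using congrArg Prod.fst ht
      exact hV'.ne_zero (by simpa [ht1] using congrArg Prod.snd ht)
  let π : N →ₗ[ℂ] V.carrier := (LinearMap.fst ℂ V.carrier V'.carrier).comp N.subtype
  have hinj : Function.Injective π := by
    rw [← LinearMap.ker_eq_bot, Submodule.eq_bot_iff]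
    rintro ⟨⟨v, v'⟩, hv⟩ hz
    obtain rfl : v = 0 := hz
    have : v' ∈ N.comap (LinearMap.inr ℂ V.carrier V'.carrier) := hv
    rw [hfib, Submodule.mem_bot] at this
    subst this
    rfl
  have hsurj : Function.Surjective π := by
    rw [← LinearMap.range_eq_top]
    refine hV.gen _ ⟨?_, ?_⟩ ⟨⟨_, huN⟩, rfl⟩
    · rintro m _ ⟨⟨v, hv⟩, rfl⟩
      exact ⟨⟨_, hinv.1 m v hv⟩, rfl⟩
    · rintro k _ ⟨⟨v, hv⟩, rfl⟩
      exact ⟨⟨_, hinv.2 k v hv⟩, rfl⟩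
  let e := LinearEquiv.ofBijective π ⟨hinj, hsurj⟩
  let g := (LinearMap.snd ℂ V.carrier V'.carrier).comp (N.subtype.comp e.symm.toLinearMap)
  have hg : ∀ z : V.carrier × V'.carrier, z ∈ N → g z.1 = z.2 := by
    intro z hz
    have : e.symm z.1 = ⟨z, hz⟩ := by
      rw [LinearEquiv.symm_apply_eq]; rfl
    simp [g, this]
  have hgr : ∀ v, (v, g v) ∈ N := by
    intro v
    obtain ⟨⟨z, hz⟩, rfl⟩ := hsurj v
    change (z.1, g z.1) ∈ N
    rw [hg z hz]
    exact hz
  exact ⟨⟨g, fun m v => hg _ (hinv.1 m _ (hgr v)), fun k v => hg _ (hinv.2 k _ (hgr v))⟩,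
    hg _ huN⟩

end Modules

section IntermediateSeries

variable {a b : ℂ} {S : NSMod 0}

theorem SA'Family.exists_linearMap (F : SA'Family a b S) {M : Type} [AddCommGroup M] [Module ℂ M]
    (p q : ℤ → M) (hq : a = 1 / 2 ∧ b = 1 / 2 → q (-1) = 0) :
    ∃ φ : S.carrier →ₗ[ℂ] M, (∀ j, φ (F.x j) = p j) ∧ ∀ j, φ (F.y j) = q j := by
  by_cases hs : a = 1 / 2 ∧ b = 1 / 2
  · obtain ⟨hy, hind⟩ := F.indep_special hs
    let B := Module.Basis.mk hind (by
      rw [← F.spans, Submodule.span_le]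
      rintro _ (⟨j, rfl⟩ | ⟨j, rfl⟩)
      · exact Submodule.subset_span ⟨Sum.inl j, rfl⟩
      · by_cases hj : j = -1
        · rw [hj, hy]; exact Submodule.zero_mem _
        · exact Submodule.subset_span ⟨Sum.inr ⟨j, hj⟩, rfl⟩)
    refine ⟨B.constr ℂ (Sum.elim p fun j => q j.1), fun j => ?_, fun j => ?_⟩
    · simpa [B] using B.constr_basis ℂ (Sum.elim p fun j => q j.1) (Sum.inl j)
    · by_cases hj : j = -1
      · rw [hj, hy, hq hs, map_zero]
      · simpa [B] using B.constr_basis ℂ (Sum.elim p fun j => q j.1) (Sum.inr ⟨j, hj⟩)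
  · let B := Module.Basis.mk (F.indep_generic hs) (by rw [Set.Sum.elim_range, F.spans])
    refine ⟨B.constr ℂ (Sum.elim p q), fun j => ?_, fun j => ?_⟩
    · simpa [B] using B.constr_basis ℂ (Sum.elim p q) (Sum.inl j)
    · simpa [B] using B.constr_basis ℂ (Sum.elim p q) (Sum.inr j)

theorem SA'Family.linearMap_ext (F : SA'Family a b S) {M : Type} [AddCommGroup M] [Module ℂ M]
    {f g : S.carrier →ₗ[ℂ] M} (hx : ∀ j, f (F.x j) = g (F.x j))
    (hy : ∀ j, f (F.y j) = g (F.y j)) : f = g := by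
  refine LinearMap.ext_on F.spans ?_
  rintro _ (⟨j, rfl⟩ | ⟨j, rfl⟩)
  · exact hx j
  · exact hy j

theorem SA'Family.exists_iso (F : SA'Family a b S) {S' : NSMod 0} (F' : SA'Family a b S') :
    ∃ g : NSHom S S', Function.Bijective g.toFun := by
  obtain ⟨φ, hx, hy⟩ := F.exists_linearMap F'.x F'.y fun hs => (F'.indep_special hs).1
  obtain ⟨ψ, hx', hy'⟩ := F'.exists_linearMap F.x F.y fun hs => (F.indep_special hs).1
  have h1 : ψ.comp φ = LinearMap.id :=
    F.linearMap_ext (fun j => by simp [hx, hx']) (fun j => by simp [hy, hy'])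
  have h2 : φ.comp ψ = LinearMap.id :=
    F'.linearMap_ext (fun j => by simp [hx, hx']) (fun j => by simp [hy, hy'])
  refine ⟨⟨φ, fun m v => ?_, fun k v => ?_⟩,
    Function.bijective_iff_has_inverse.2 ⟨ψ, LinearMap.congr_fun h1, LinearMap.congr_fun h2⟩⟩
  · have : φ.comp (S.L m) = (S'.L m).comp φ := F.linearMap_ext
      (fun j => by simp [hx, F.act_Lx, F'.act_Lx]) (fun j => by simp [hy, F.act_Ly, F'.act_Ly])
    exact LinearMap.congr_fun this v
  · have : φ.comp (S.G k) = (S'.G k).comp φ := F.linearMap_ext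
      (fun j => by simp [hx, hy, F.act_Gx, F'.act_Gx])
      (fun j => by simp [hx, hy, F.act_Gy, F'.act_Gy])
    exact LinearMap.congr_fun this v

/-- The coordinate of a vector of `SA'_{a,b}` along `x l`. -/
def SA'Family.xCoord (F : SA'Family a b S) (l : ℤ) : S.carrier →ₗ[ℂ] ℂ :=
  (F.exists_linearMap (fun j => if j = l then 1 else 0) (fun _ => 0) fun _ => rfl).choose

/-- The coordinate of a vector of `SA'_{a,b}` along `y l`; it is zero when `y l` vanishes. -/
def SA'Family.yCoord (F : SA'Family a b S) (l : ℤ) : S.carrier →ₗ[ℂ] ℂ :=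
  (F.exists_linearMap (fun _ => 0)
    (fun j => if j = l ∧ ¬((a = 1 / 2 ∧ b = 1 / 2) ∧ l = -1) then 1 else 0)
    fun hs => if_neg fun h => h.2 ⟨hs, h.1.symm⟩).choose

theorem SA'Family.xCoord_x (F : SA'Family a b S) (l j : ℤ) :
    F.xCoord l (F.x j) = if j = l then 1 else 0 :=
  (F.exists_linearMap (fun j => if j = l then 1 else 0) (fun _ => 0)
    fun _ => rfl).choose_spec.1 j

theorem SA'Family.xCoord_y (F : SA'Family a b S) (l j : ℤ) : F.xCoord l (F.y j) = 0 :=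
  (F.exists_linearMap (fun j => if j = l then 1 else 0) (fun _ => 0)
    fun _ => rfl).choose_spec.2 j

theorem SA'Family.yCoord_x (F : SA'Family a b S) (l j : ℤ) : F.yCoord l (F.x j) = 0 :=
  (F.exists_linearMap (fun _ => 0)
    (fun j => if j = l ∧ ¬((a = 1 / 2 ∧ b = 1 / 2) ∧ l = -1) then 1 else 0)
    fun hs => if_neg fun h => h.2 ⟨hs, h.1.symm⟩).choose_spec.1 j

theorem SA'Family.yCoord_y (F : SA'Family a b S) (l j : ℤ) :
    F.yCoord l (F.y j) = if j = l ∧ ¬((a = 1 / 2 ∧ b = 1 / 2) ∧ l = -1) then 1 else 0 :=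
  (F.exists_linearMap (fun _ => 0)
    (fun j => if j = l ∧ ¬((a = 1 / 2 ∧ b = 1 / 2) ∧ l = -1) then 1 else 0)
    fun hs => if_neg fun h => h.2 ⟨hs, h.1.symm⟩).choose_spec.2 j

theorem SA'Family.yCoord_special (F : SA'Family a b S) (hs : a = 1 / 2 ∧ b = 1 / 2) :
    F.yCoord (-1) = 0 :=
  F.linearMap_ext (fun j => by simp [F.yCoord_x])
    (fun j => by rw [F.yCoord_y, if_neg fun h => h.2 ⟨hs, rfl⟩]; rfl)

theorem SA'Family.xCoord_L (F : SA'Family a b S) (l i : ℤ) (s : S.carrier) :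
    F.xCoord (l + i) (S.L i s) = (a + l + i * b) * F.xCoord l s := by
  have : (F.xCoord (l + i)).comp (S.L i) = (a + l + i * b) • F.xCoord l := by
    refine F.linearMap_ext (fun j => ?_) (fun j => ?_)
    · by_cases hj : j = l
      · simp [F.act_Lx, F.xCoord_x, hj, add_comm]
      · simp [F.act_Lx, F.xCoord_x, hj, add_comm i]
    · simp [F.act_Ly, F.xCoord_y]
  exact LinearMap.congr_fun this s

theorem SA'Family.xCoord_G (F : SA'Family a b S) (l i : ℤ) (s : S.carrier) :
    F.xCoord (l + i + 1) (S.G i s)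
      = (a + 1 / 2 + l + (2 * i + 1) * (b - 1 / 2)) * F.yCoord l s := by
  have : (F.xCoord (l + i + 1)).comp (S.G i)
      = (a + 1 / 2 + l + (2 * i + 1) * (b - 1 / 2)) • F.yCoord l := by
    refine F.linearMap_ext (fun j => ?_) (fun j => ?_)
    · simp [F.act_Gx, F.xCoord_y, F.yCoord_x]
    · rw [LinearMap.comp_apply, F.act_Gy, map_smul, F.xCoord_x, LinearMap.smul_apply, F.yCoord_y]
      by_cases hj : j = l
      · subst hj
        by_cases hs : (a = 1 / 2 ∧ b = 1 / 2) ∧ j = -1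
        · obtain ⟨⟨rfl, rfl⟩, rfl⟩ := hs
          norm_num
        · rw [if_pos (by omega), if_pos ⟨rfl, hs⟩]
      · rw [if_neg (by omega), if_neg fun h => hj h.1, smul_zero, smul_zero]
  exact LinearMap.congr_fun this s

theorem SA'Family.yCoord_G (F : SA'Family a b S) (l i : ℤ)
    (h : ¬((a = 1 / 2 ∧ b = 1 / 2) ∧ l + i = -1)) (s : S.carrier) :
    F.yCoord (l + i) (S.G i s) = F.xCoord l s := by
  have : (F.yCoord (l + i)).comp (S.G i) = F.xCoord l := by
    refine F.linearMap_ext (fun j => ?_) (fun j => ?_)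
    · rw [LinearMap.comp_apply, F.act_Gx, F.yCoord_y, F.xCoord_x]
      by_cases hj : j = l
      · rw [if_pos ⟨by omega, h⟩, if_pos hj]
      · rw [if_neg fun h => hj (by omega), if_neg hj]
    · simp [F.act_Gy, F.xCoord_y, F.yCoord_x]
  exact LinearMap.congr_fun this s

end IntermediateSeries

section Tensor

variable {a b c : ℂ} {V : NSMod c} {S : NSMod 0} {T : NSMod c}

theorem TensorWitness.actG (tw : TensorWitness V S T) (k : ℤ) (v : V.carrier) (s : S.carrier) :
    T.G k (tw.t v s) = tw.t (V.G k v) s + tw.t (V.sgn v) (S.G k s) := by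
  obtain ⟨e, he, o, ho, rfl⟩ := V.exists_even_add_odd v
  simp only [map_add, LinearMap.add_apply, tw.actG_even k e he, tw.actG_odd k o ho,
    V.sgn_even he, V.sgn_odd ho, map_neg, LinearMap.neg_apply]
  abel

/-- The linear map `V ⊗ S → V` contracting the second factor with the functional `φ`. -/
def TensorWitness.coeff (tw : TensorWitness V S T) (φ : S.carrier →ₗ[ℂ] ℂ) :
    T.carrier →ₗ[ℂ] V.carrier :=
  tw.isTensor.lift ((LinearMap.lsmul ℂ V.carrier).comp φ).flip

theorem TensorWitness.coeff_t (tw : TensorWitness V S T) (φ : S.carrier →ₗ[ℂ] ℂ)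
    (v : V.carrier) (s : S.carrier) : tw.coeff φ (tw.t v s) = φ s • v := by
  simp [TensorWitness.coeff, IsTensorProduct.lift_eq]

/-- The span of the pure tensors whose first factor is annihilated by all `L i` and `G i` with
`i ≥ N`. -/
def TensorWitness.level (tw : TensorWitness V S T) (N : ℤ) : Submodule ℂ T.carrier :=
  Submodule.span ℂ {z | ∃ v ∈ V.tail N, ∃ s, tw.t v s = z}

theorem TensorWitness.t_mem_level (tw : TensorWitness V S T) {N : ℤ} {v : V.carrier}
    (hv : v ∈ V.tail N) (s : S.carrier) : tw.t v s ∈ tw.level N :=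
  Submodule.subset_span ⟨v, hv, s, rfl⟩

theorem TensorWitness.level_mono (tw : TensorWitness V S T) {M N : ℤ} (h : M ≤ N) :
    tw.level M ≤ tw.level N :=
  Submodule.span_mono fun _ ⟨v, hv, s, hs⟩ => ⟨v, V.tail_mono h hv, s, hs⟩

theorem TensorWitness.exists_mem_level (tw : TensorWitness V S T) {h : ℂ} {u : V.carrier}
    (hV : IsHW h V u) (z : T.carrier) : ∃ N, z ∈ tw.level N := by
  refine tw.isTensor.inductionOn z ⟨0, Submodule.zero_mem _⟩ (fun v s => ?_) ?_
  · obtain ⟨N, hN⟩ := hV.exists_mem_tail v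
    exact ⟨N, tw.t_mem_level hN s⟩
  · rintro z w ⟨M, hM⟩ ⟨N, hN⟩
    exact ⟨max M N, Submodule.add_mem _ (tw.level_mono (le_max_left _ _) hM)
      (tw.level_mono (le_max_right _ _) hN)⟩

theorem TensorWitness.L_t (tw : TensorWitness V S T) {N i : ℤ} (hi : N ≤ i) {v : V.carrier}
    (hv : v ∈ V.tail N) (s : S.carrier) : T.L i (tw.t v s) = tw.t v (S.L i s) := by
  simp [tw.actL, (hv i hi).1]

theorem TensorWitness.G_t (tw : TensorWitness V S T) {N i : ℤ} (hi : N ≤ i) {v : V.carrier}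
    (hv : v ∈ V.tail N) (s : S.carrier) : T.G i (tw.t v s) = tw.t (V.sgn v) (S.G i s) := by
  simp [tw.actG, (hv i hi).2]

theorem TensorWitness.G_mem_level (tw : TensorWitness V S T) {N i : ℤ} (hi : N ≤ i)
    {z : T.carrier} (hz : z ∈ tw.level N) : T.G i z ∈ tw.level N := by
  have : tw.level N ≤ (tw.level N).comap (T.G i) := by
    refine Submodule.span_le.2 ?_
    rintro _ ⟨v, hv, s, rfl⟩
    change T.G i (tw.t v s) ∈ tw.level N
    rw [tw.G_t hi hv]
    exact tw.t_mem_level (V.sgn_mem_tail hv) _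
  exact this hz

theorem TensorWitness.coeff_L (tw : TensorWitness V S T) {N i : ℤ} (hi : N ≤ i)
    {φ ψ : S.carrier →ₗ[ℂ] ℂ} {r : ℂ} (hφ : ∀ s, φ (S.L i s) = r * ψ s)
    {z : T.carrier} (hz : z ∈ tw.level N) : tw.coeff φ (T.L i z) = r • tw.coeff ψ z := by
  have : tw.level N ≤ LinearMap.eqLocus ((tw.coeff φ).comp (T.L i)) (r • tw.coeff ψ) := by
    refine Submodule.span_le.2 ?_
    rintro _ ⟨v, hv, s, rfl⟩
    simp [tw.L_t hi hv, tw.coeff_t, hφ, mul_smul]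
  exact this hz

theorem TensorWitness.coeff_G (tw : TensorWitness V S T) {N i : ℤ} (hi : N ≤ i)
    {φ ψ : S.carrier →ₗ[ℂ] ℂ} {r : ℂ} (hφ : ∀ s, φ (S.G i s) = r * ψ s)
    {z : T.carrier} (hz : z ∈ tw.level N) :
    tw.coeff φ (T.G i z) = r • V.sgn (tw.coeff ψ z) := by
  have : tw.level N ≤
      LinearMap.eqLocus ((tw.coeff φ).comp (T.G i)) (r • V.sgn.comp (tw.coeff ψ)) := by
    refine Submodule.span_le.2 ?_
    rintro _ ⟨v, hv, s, rfl⟩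
    simp [tw.G_t hi hv, tw.coeff_t, hφ, mul_smul]
  exact this hz

/-- An element of `V ⊗ SA'_{a,b}` is determined by its coordinates. -/
theorem TensorWitness.ext_coeff (tw : TensorWitness V S T) (F : SA'Family a b S) {z w : T.carrier}
    (hx : ∀ l, tw.coeff (F.xCoord l) z = tw.coeff (F.xCoord l) w)
    (hy : ∀ l, tw.coeff (F.yCoord l) z = tw.coeff (F.yCoord l) w) : z = w := by
  have key : ∀ z, ∃ A : Finset ℤ, ∀ B, A ⊆ B →
      z = ∑ l ∈ B, (tw.t (tw.coeff (F.xCoord l) z) (F.x l)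
        + tw.t (tw.coeff (F.yCoord l) z) (F.y l)) := by
    have hadd : ∀ z w, (∃ A : Finset ℤ, ∀ B, A ⊆ B →
        z = ∑ l ∈ B, (tw.t (tw.coeff (F.xCoord l) z) (F.x l)
          + tw.t (tw.coeff (F.yCoord l) z) (F.y l))) → (∃ A : Finset ℤ, ∀ B, A ⊆ B →
        w = ∑ l ∈ B, (tw.t (tw.coeff (F.xCoord l) w) (F.x l)
          + tw.t (tw.coeff (F.yCoord l) w) (F.y l))) → (∃ A : Finset ℤ, ∀ B, A ⊆ B →
        z + w = ∑ l ∈ B, (tw.t (tw.coeff (F.xCoord l) (z + w)) (F.x l)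
          + tw.t (tw.coeff (F.yCoord l) (z + w)) (F.y l))) := by
      rintro z w ⟨A, hA⟩ ⟨A', hA'⟩
      refine ⟨A ∪ A', fun B hB => ?_⟩
      conv_lhs => rw [hA B (Finset.union_subset_left hB), hA' B (Finset.union_subset_right hB),
        ← Finset.sum_add_distrib]
      refine Finset.sum_congr rfl fun l _ => ?_
      simp only [map_add, LinearMap.add_apply]
      abel
    intro z
    refine tw.isTensor.inductionOn z ⟨∅, fun B _ => by simp⟩ (fun v s => ?_) hadd
    have hs : s ∈ Submodule.span ℂ (Set.range F.x ∪ Set.range F.y) :=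
      F.spans ▸ Submodule.mem_top
    induction hs using Submodule.span_induction with
    | mem s hs =>
      rcases hs with ⟨j, rfl⟩ | ⟨j, rfl⟩
      · refine ⟨{j}, fun B hB => ?_⟩
        rw [Finset.sum_eq_single j]
        · simp [tw.coeff_t, F.xCoord_x, F.yCoord_x]
        · intro l _ hl
          simp [tw.coeff_t, F.xCoord_x, F.yCoord_x, hl.symm]
        · exact fun h => absurd (hB (Finset.mem_singleton_self j)) h
      · refine ⟨{j}, fun B hB => ?_⟩
        rw [Finset.sum_eq_single j]
        · by_cases hs : (a = 1 / 2 ∧ b = 1 / 2) ∧ j = -1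
          · rw [hs.2, (F.indep_special hs.1).1]
            simp
          · rw [tw.coeff_t, tw.coeff_t, F.xCoord_y, F.yCoord_y, if_pos ⟨rfl, hs⟩]
            simp
        · intro l _ hl
          simp [tw.coeff_t, F.xCoord_y, F.yCoord_y, hl.symm]
        · exact fun h => absurd (hB (Finset.mem_singleton_self j)) h
    | zero => exact ⟨∅, fun B _ => by simp⟩
    | add s s' _ _ h h' => rw [map_add]; exact hadd _ _ h h'
    | smul r s _ h =>
      obtain ⟨A, hA⟩ := h
      refine ⟨A, fun B hB => ?_⟩
      rw [map_smul]
      conv_lhs => rw [hA B hB, Finset.smul_sum]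
      refine Finset.sum_congr rfl fun l _ => ?_
      simp only [map_smul, LinearMap.smul_apply, smul_add]
  obtain ⟨A, hA⟩ := key z
  obtain ⟨A', hA'⟩ := key w
  rw [hA _ (Finset.subset_union_left (s₂ := A')), hA' _ (Finset.subset_union_right (s₁ := A))]
  exact Finset.sum_congr rfl fun l _ => by rw [hx, hy]

theorem TensorWitness.xCoeff_G_G (tw : TensorWitness V S T) (F : SA'Family a b S) {N p q : ℤ}
    (hp : N ≤ p) (hq : N ≤ q) (l : ℤ) {z : T.carrier} (hz : z ∈ tw.level N) :
    tw.coeff (F.xCoord (l + p + q + 1)) (T.G p (T.G q z))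
      = (a + 1 / 2 + l + q + (2 * p + 1) * (b - 1 / 2)) • tw.coeff (F.xCoord l) z := by
  have e : l + p + q + 1 = (l + q) + p + 1 := by ring
  rw [e, tw.coeff_G hp (F.xCoord_G (l + q) p) (tw.G_mem_level hq hz)]
  by_cases hs : (a = 1 / 2 ∧ b = 1 / 2) ∧ l + q = -1
  · obtain ⟨⟨rfl, rfl⟩, hl⟩ := hs
    obtain rfl : l = -1 - q := by omega
    have e0 : (1 / 2 : ℂ) + 1 / 2 + ((-1 - q : ℤ) : ℂ) + q
        + (2 * p + 1) * (1 / 2 - 1 / 2) = 0 := by push_cast; ring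
    have e1 : (1 / 2 : ℂ) + 1 / 2 + ((-1 - q + q : ℤ) : ℂ)
        + (2 * p + 1) * (1 / 2 - 1 / 2) = 0 := by push_cast; ring
    rw [e0, e1, zero_smul, zero_smul]
  · rw [tw.coeff_G hq (r := 1) (fun s => by rw [one_mul, F.yCoord_G l q hs]) hz, one_smul,
      V.sgn_sgn]
    push_cast
    congr 1
    ring

theorem TensorWitness.yCoeff_G_G (tw : TensorWitness V S T) (F : SA'Family a b S) {N p q : ℤ}
    (hp : N ≤ p) (hq : N ≤ q) (l : ℤ) (hs : ¬((a = 1 / 2 ∧ b = 1 / 2) ∧ l + p + q + 1 = -1))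
    {z : T.carrier} (hz : z ∈ tw.level N) :
    tw.coeff (F.yCoord (l + p + q + 1)) (T.G p (T.G q z))
      = (a + 1 / 2 + l + (2 * q + 1) * (b - 1 / 2)) • tw.coeff (F.yCoord l) z := by
  have e : l + p + q + 1 = (l + q + 1) + p := by ring
  rw [e] at hs ⊢
  rw [tw.coeff_G hp (r := 1) (fun s => by rw [one_mul, F.yCoord_G (l + q + 1) p hs])
    (tw.G_mem_level hq hz), one_smul, tw.coeff_G hq (F.xCoord_G l q) hz, map_smul, V.sgn_sgn]

/-- The second-order operator that acts on `V ⊗ SA'_{a,b}` asymptotically as a rescaled shift of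
the index of the second factor. -/
def NSMod.shift (T : NSMod c) (p q : ℤ) : T.carrier →ₗ[ℂ] T.carrier :=
  (T.G p).comp (T.G (q + 1)) - (T.G (p + 1)).comp (T.G q)

theorem NSHom.comm_shift {c' : ℂ} {T' : NSMod c'} (f : NSHom T T') (p q : ℤ) (z : T.carrier) :
    f.toFun (T.shift p q z) = T'.shift p q (f.toFun z) := by
  simp [NSMod.shift, f.commG]

theorem TensorWitness.xCoeff_shift (tw : TensorWitness V S T) (F : SA'Family a b S) {N p q : ℤ}
    (hp : N ≤ p) (hq : N ≤ q) (l : ℤ) {z : T.carrier} (hz : z ∈ tw.level N) :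
    tw.coeff (F.xCoord (l + (p + q + 2))) (T.shift p q z)
      = (2 - 2 * b) • tw.coeff (F.xCoord l) z := by
  have h1 := tw.xCoeff_G_G F hp (hq.trans (Int.le_add_one le_rfl)) l hz
  have h2 := tw.xCoeff_G_G F (hp.trans (Int.le_add_one le_rfl)) hq l hz
  rw [show l + p + (q + 1) + 1 = l + (p + q + 2) by ring] at h1
  rw [show l + (p + 1) + q + 1 = l + (p + q + 2) by ring] at h2
  simp only [NSMod.shift, LinearMap.sub_apply, LinearMap.comp_apply, map_sub, h1, h2, ← sub_smul]
  congr 1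
  push_cast
  ring

theorem TensorWitness.yCoeff_shift (tw : TensorWitness V S T) (F : SA'Family a b S) {N p q : ℤ}
    (hp : N ≤ p) (hq : N ≤ q) (l : ℤ) {z : T.carrier} (hz : z ∈ tw.level N) :
    tw.coeff (F.yCoord (l + (p + q + 2))) (T.shift p q z)
      = (2 * b - 1) • tw.coeff (F.yCoord l) z := by
  by_cases hs : (a = 1 / 2 ∧ b = 1 / 2) ∧ l + (p + q + 2) = -1
  · have hd : 2 * b - 1 = 0 := by rw [hs.1.2]; norm_num
    rw [hs.2, F.yCoord_special hs.1, hd, zero_smul]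
    refine tw.isTensor.inductionOn (T.shift p q z) (map_zero _) (fun v s => ?_)
      fun z w hz hw => by rw [map_add, hz, hw, add_zero]
    rw [tw.coeff_t, LinearMap.zero_apply, zero_smul]
  · have e1 : l + p + (q + 1) + 1 = l + (p + q + 2) := by ring
    have e2 : l + (p + 1) + q + 1 = l + (p + q + 2) := by ring
    have h1 := tw.yCoeff_G_G F hp (hq.trans (Int.le_add_one le_rfl)) l (by rwa [e1]) hz
    have h2 := tw.yCoeff_G_G F (hp.trans (Int.le_add_one le_rfl)) hq l (by rwa [e2]) hz
    rw [e1] at h1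
    rw [e2] at h2
    simp only [NSMod.shift, LinearMap.sub_apply, LinearMap.comp_apply, map_sub, h1, h2, ← sub_smul]
    congr 1
    push_cast
    ring

theorem TensorWitness.shift_t_x (tw : TensorWitness V S T) (F : SA'Family a b S) {N p q : ℤ}
    (hp : N ≤ p) (hq : N ≤ q) {v : V.carrier} (hv : v ∈ V.tail N) (j : ℤ) :
    T.shift p q (tw.t v (F.x j)) = (2 - 2 * b) • tw.t v (F.x (j + (p + q + 2))) := by
  have hv' := V.sgn_mem_tail hv
  simp only [NSMod.shift, LinearMap.sub_apply, LinearMap.comp_apply,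
    tw.G_t (hq.trans (Int.le_add_one le_rfl)) hv, tw.G_t hq hv, tw.G_t hp hv',
    tw.G_t (hp.trans (Int.le_add_one le_rfl)) hv', V.sgn_sgn, F.act_Gx, F.act_Gy, map_smul]
  rw [show p + (q + 1 + j) + 1 = j + (p + q + 2) by ring,
    show p + 1 + (q + j) + 1 = j + (p + q + 2) by ring, ← sub_smul]
  congr 1
  push_cast
  ring

end Tensor

section Asymptotics

variable {a b c a' b' c' : ℂ} {V : NSMod c} {V' : NSMod c'} {S S' : NSMod 0}
  {T : NSMod c} {T' : NSMod c'} (tw : TensorWitness V S T) (tw' : TensorWitness V' S' T')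
  (F : SA'Family a b S) (F' : SA'Family a' b' S') (f : NSHom T T')

theorem map_t_x_mem_level (hb : b ≠ 1) {N j s : ℤ} {v : V.carrier} (hv : v ∈ V.tail N)
    (hf : f.toFun (tw.t v (F.x j)) ∈ tw'.level N) (hs : 2 * N + 2 ≤ s) :
    f.toFun (tw.t v (F.x (j + s))) ∈ tw'.level N := by
  have h := tw.shift_t_x F (p := N) (q := s - 2 - N) le_rfl (by omega) hv j
  rw [show j + (N + (s - 2 - N) + 2) = j + s by ring] at h
  have h2 : (2 - 2 * b) ≠ 0 := fun h0 => hb (by linear_combination (-1 / 2) * h0)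
  rw [← Submodule.smul_mem_iff _ h2, ← map_smul, ← h, f.comm_shift]
  exact Submodule.sub_mem _
    (tw'.G_mem_level le_rfl (tw'.G_mem_level (by omega) hf))
    (tw'.G_mem_level (by omega) (tw'.G_mem_level (by omega) hf))

theorem xCoeff_map_t_x {N j s : ℤ} {v : V.carrier} (hv : v ∈ V.tail N)
    (hf : f.toFun (tw.t v (F.x j)) ∈ tw'.level N) (hs : 2 * N + 2 ≤ s) (l : ℤ) :
    (2 - 2 * b) • tw'.coeff (F'.xCoord (l + s)) (f.toFun (tw.t v (F.x (j + s))))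
      = (2 - 2 * b') • tw'.coeff (F'.xCoord l) (f.toFun (tw.t v (F.x j))) := by
  have h := tw.shift_t_x F (p := N) (q := s - 2 - N) le_rfl (by omega) hv j
  have h' := tw'.xCoeff_shift F' (p := N) (q := s - 2 - N) le_rfl (by omega) l hf
  rw [show N + (s - 2 - N) + 2 = s by ring] at h h'
  rw [← h', ← f.comm_shift, h, map_smul, map_smul]

theorem yCoeff_map_t_x {N j s : ℤ} {v : V.carrier} (hv : v ∈ V.tail N)
    (hf : f.toFun (tw.t v (F.x j)) ∈ tw'.level N) (hs : 2 * N + 2 ≤ s) (l : ℤ) :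
    (2 - 2 * b) • tw'.coeff (F'.yCoord (l + s)) (f.toFun (tw.t v (F.x (j + s))))
      = (2 * b' - 1) • tw'.coeff (F'.yCoord l) (f.toFun (tw.t v (F.x j))) := by
  have h := tw.shift_t_x F (p := N) (q := s - 2 - N) le_rfl (by omega) hv j
  have h' := tw'.yCoeff_shift F' (p := N) (q := s - 2 - N) le_rfl (by omega) l hf
  rw [show N + (s - 2 - N) + 2 = s by ring] at h h'
  rw [← h', ← f.comm_shift, h, map_smul, map_smul]

theorem yCoeff_map_t_x_eq_zero (hb : b ≠ 1) (hb' : b' ≠ 1) {N j s : ℤ} {v : V.carrier}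
    (hv : v ∈ V.tail N) (hf : f.toFun (tw.t v (F.x j)) ∈ tw'.level N) (hs : 2 * N + 3 ≤ s)
    (l : ℤ) : tw'.coeff (F'.yCoord l) (f.toFun (tw.t v (F.x (j + s)))) = 0 := by
  obtain ⟨l, rfl⟩ : ∃ m, l = m + s := ⟨l - s, by ring⟩
  have h2 : (2 - 2 * b) ≠ 0 := fun h0 => hb (by linear_combination (-1 / 2) * h0)
  have h2' : (2 - 2 * b') ≠ 0 := fun h0 => hb' (by linear_combination (-1 / 2) * h0)
  have y1 := yCoeff_map_t_x tw tw' F F' f hv hf (s := s) (by omega) l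
  have y2 := yCoeff_map_t_x tw tw' F F' f hv hf (s := s - 1) (by omega) l
  have m1 := map_t_x_mem_level tw tw' F f hb hv hf (s := s) (by omega)
  have m2 := map_t_x_mem_level tw tw' F f hb hv hf (s := s - 1) (by omega)
  have hG : T.G N (tw.t v (F.x (j + s))) = T.G (N + 1) (tw.t v (F.x (j + (s - 1)))) := by
    rw [tw.G_t le_rfl hv, tw.G_t (by omega) hv, F.act_Gx, F.act_Gx,
      show N + 1 + (j + (s - 1)) = N + (j + s) by ring]
  have hfG := congrArg f.toFun hG
  rw [f.commG, f.commG] at hfG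
  have g1 := tw'.coeff_G (i := N) le_rfl (F'.xCoord_G (l + s) N) m1
  have g2 := tw'.coeff_G (i := N + 1) (by omega) (F'.xCoord_G (l + (s - 1)) (N + 1)) m2
  rw [show l + (s - 1) + (N + 1) + 1 = l + s + N + 1 by ring, ← hfG, g1] at g2
  have z1 := congrArg V'.sgn y1
  have z2 := congrArg V'.sgn y2
  rw [map_smul, map_smul] at z1 z2
  have g4 : ((2 - 2 * b') * (2 * b' - 1)) • V'.sgn
      (tw'.coeff (F'.yCoord l) (f.toFun (tw.t v (F.x j)))) = 0 := by
    push_cast at g2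
    linear_combination (norm := module) (2 - 2 * b) • g2
      - (a' + 1 / 2 + ((l : ℂ) + s) + (2 * N + 1) * (b' - 1 / 2)) • z1
      + (a' + 1 / 2 + ((l : ℂ) + (s - 1)) + (2 * (N + 1) + 1) * (b' - 1 / 2)) • z2
  have g5 : (2 * b' - 1) • tw'.coeff (F'.yCoord l) (f.toFun (tw.t v (F.x j))) = 0 := by
    rw [mul_smul, smul_eq_zero_iff_right h2'] at g4
    rw [← V'.sgn_sgn (_ • _), map_smul, g4, map_zero]
  rw [g5, smul_eq_zero_iff_right h2] at y1
  exact y1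

theorem exists_xCoeff_map_ne_zero (hinj : Function.Injective f.toFun) (hb : b ≠ 1)
    (hb' : b' ≠ 1) {N j s : ℤ} {v : V.carrier} (hv : v ∈ V.tail N)
    (hf : f.toFun (tw.t v (F.x j)) ∈ tw'.level N) (hs : 2 * N + 3 ≤ s) (hv0 : v ≠ 0) :
    ∃ l, tw'.coeff (F'.xCoord (l + s)) (f.toFun (tw.t v (F.x (j + s)))) ≠ 0 := by
  by_contra! h
  have : f.toFun (tw.t v (F.x (j + s))) = 0 := tw'.ext_coeff F'
    (fun l => by simpa using h (l - s))
    (fun l => by rw [yCoeff_map_t_x_eq_zero tw tw' F F' f hb hb' hv hf hs, map_zero])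
  have h0 : tw.t v (F.x (j + s)) = 0 := hinj (by rw [this, map_zero])
  apply hv0
  have := tw.coeff_t (F.xCoord (j + s)) v (F.x (j + s))
  rw [h0, map_zero, F.xCoord_x, if_pos rfl, one_smul] at this
  exact this.symm

end Asymptotics

section Intertwiner

variable {a b c a' b' c' : ℂ} {V : NSMod c} {V' : NSMod c'} {S S' : NSMod 0}
  {T : NSMod c} {T' : NSMod c'} (tw : TensorWitness V S T) (tw' : TensorWitness V' S' T')

theorem eq_b_of_injective (F : SA'Family a b S) (F' : SA'Family a' b' S') (f : NSHom T T')
    (hinj : Function.Injective f.toFun) (hb : b ≠ 1)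
    (hb' : b' ≠ 1) {N j : ℤ} (hN : 0 ≤ N) {v : V.carrier} (hv : v ∈ V.tail N)
    (hf : f.toFun (tw.t v (F.x j)) ∈ tw'.level N) (hv0 : v ≠ 0) : b = b' := by
  obtain ⟨M, hM⟩ : ∃ M, M = 2 * N + 3 := ⟨_, rfl⟩
  have h2 : (2 - 2 * b) ≠ 0 := fun h0 => hb (by linear_combination (-1 / 2) * h0)
  obtain ⟨l, hl⟩ := exists_xCoeff_map_ne_zero tw tw' F F' f hinj hb hb' hv hf (s := M)
    (by omega) hv0
  have m1 := map_t_x_mem_level tw tw' F f hb hv hf (s := M) (by omega)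
  have x1 := xCoeff_map_t_x tw tw' F F' f hv hf (s := M) (by omega) l
  have x2 := xCoeff_map_t_x tw tw' F F' f hv hf (s := M + M) (by omega) l
  have x3 := xCoeff_map_t_x tw tw' F F' f hv m1 (s := M) (by omega) (l + M)
  rw [add_assoc, add_assoc, x2, ← x1] at x3
  have := smul_left_injective ℂ hl x3
  linear_combination (-1 / 2) * this

theorem smul_xCoeff_map_eq_zero (F : SA'Family a b S) (F' : SA'Family a' b S') (f : NSHom T T')
    (hb : b ≠ 1) {N : ℤ} (hN : 0 ≤ N) {v : V.carrier} (hv : v ∈ V.tail N) {j : ℤ}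
    (hf : f.toFun (tw.t v (F.x j)) ∈ tw'.level N) (l : ℤ) :
    (a' + l - (a + j)) • tw'.coeff (F'.xCoord l) (f.toFun (tw.t v (F.x j))) = 0 := by
  obtain ⟨M, hM⟩ : ∃ M, M = 2 * N + 3 := ⟨_, rfl⟩
  have h2 : (2 - 2 * b) ≠ 0 := fun h0 => hb (by linear_combination (-1 / 2) * h0)
  have m1 := map_t_x_mem_level tw tw' F f hb hv hf (s := M) (by omega)
  have x1 := xCoeff_map_t_x tw tw' F F' f hv hf (s := M) (by omega) l
  have x2 := xCoeff_map_t_x tw tw' F F' f hv hf (s := M + M) (by omega) l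
  replace x1 := smul_right_injective _ h2 x1
  replace x2 := smul_right_injective _ h2 x2
  have e := tw'.coeff_L (i := M) (by omega) (F'.xCoord_L (l + M) M) m1
  rw [← f.commL, tw.L_t (by omega) hv, F.act_Lx, map_smul, map_smul, map_smul, x1,
    show M + (j + M) = j + (M + M) by ring, add_assoc l, x2, ← sub_eq_zero, ← sub_smul] at e
  rw [← neg_eq_zero, ← neg_smul, ← e]
  congr 1
  push_cast
  ring

/-- The hypothesis says that `f (v ⊗ x s) = g v ⊗ x s` for all large `s`. -/
theorem exists_hom_of_eventually (F : SA'Family a b S) (F' : SA'Family a b S') (f : NSHom T T')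
    (hV : ∀ v : V.carrier, ∃ N, v ∈ V.tail N) (hV' : ∀ v : V'.carrier, ∃ N, v ∈ V'.tail N)
    (g : V.carrier →ₗ[ℂ] V'.carrier)
    (hg : ∀ v, ∃ M : ℤ, ∀ s, M ≤ s → f.toFun (tw.t v (F.x s)) = tw'.t (g v) (F'.x s)) :
    ∃ φ : NSHom V V', φ.toFun = g := by
  have cancel : ∀ (w w' : V'.carrier) (s : ℤ), tw'.t w (F'.x s) = tw'.t w' (F'.x s) → w = w' := by
    intro w w' s h
    have := congrArg (tw'.coeff (F'.xCoord s)) h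
    rwa [tw'.coeff_t, tw'.coeff_t, F'.xCoord_x, if_pos rfl, one_smul, one_smul] at this
  have hy : ∀ v, ∃ M : ℤ, ∀ s, M ≤ s →
      f.toFun (tw.t (V.sgn v) (F.y s)) = tw'.t (V'.sgn (g v)) (F'.y s) := by
    intro v
    obtain ⟨M, hM⟩ := hg v
    obtain ⟨N, hN⟩ := hV v
    obtain ⟨N', hN'⟩ := hV' (g v)
    refine ⟨M + max N N', fun s hs => ?_⟩
    have h1 := hM (s - max N N') (by omega)
    have h2 := congrArg (T'.G (max N N')) h1
    rwa [← f.commG, tw.G_t (le_max_left _ _) hN, tw'.G_t (le_max_right _ _) hN', F.act_Gx,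
      F'.act_Gx, show max N N' + (s - max N N') = s by ring] at h2
  refine ⟨⟨g, fun m v => ?_, fun k v => ?_⟩, rfl⟩
  · obtain ⟨M, hM⟩ := hg v
    obtain ⟨M', hM'⟩ := hg (V.L m v)
    obtain ⟨s, hs⟩ : ∃ s, s = |M| + |M'| + |m| := ⟨_, rfl⟩
    have h1 := le_abs_self M
    have h2 := le_abs_self M'
    have h3 := neg_abs_le m
    have h4 := abs_nonneg M
    have h5 := abs_nonneg M'
    have h6 := abs_nonneg m
    have e := f.commL m (tw.t v (F.x s))
    rw [tw.actL, hM s (by omega), tw'.actL, F.act_Lx, F'.act_Lx, map_add, hM' s (by omega),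
      map_smul, map_smul, map_smul, hM (m + s) (by omega)] at e
    exact cancel _ _ s (add_right_cancel e)
  · obtain ⟨M, hM⟩ := hg v
    obtain ⟨M', hM'⟩ := hg (V.G k v)
    obtain ⟨M'', hM''⟩ := hy v
    obtain ⟨s, hs⟩ : ∃ s, s = |M| + |M'| + |M''| + |k| := ⟨_, rfl⟩
    have h1 := le_abs_self M
    have h2 := le_abs_self M'
    have h3 := neg_abs_le k
    have h4 := abs_nonneg M
    have h5 := abs_nonneg M'
    have h6 := abs_nonneg k
    have h7 := le_abs_self M''
    have h8 := abs_nonneg M''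
    have e := f.commG k (tw.t v (F.x s))
    rw [tw.actG, hM s (by omega), tw'.actG, F.act_Gx, F'.act_Gx, map_add, hM' s (by omega),
      hM'' (k + s) (by omega)] at e
    exact cancel _ _ s (add_right_cancel e)

end Intertwiner

section Comparison

variable {a b c h a' b' c' h' : ℂ} {V : NSMod c} {V' : NSMod c'} {S S' : NSMod 0}
  {T : NSMod c} {T' : NSMod c'}

theorem parameters_eq_of_injective (ha0 : 0 ≤ a.re) (ha1 : a.re < 1) (hb : b ≠ 1)
    (ha0' : 0 ≤ a'.re) (ha1' : a'.re < 1) (hb' : b' ≠ 1) {u : V.carrier} (hV : IsHW h V u)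
    {u' : V'.carrier} (hV' : IsHW h' V' u') (hs' : V'.IsSimple) (F : SA'Family a b S)
    (F' : SA'Family a' b' S') (tw : TensorWitness V S T) (tw' : TensorWitness V' S' T')
    (f : NSHom T T') (hinj : Function.Injective f.toFun) :
    c = c' ∧ h = h' ∧ a = a' ∧ b = b' := by
  have hlev : ∀ v : V.carrier, ∃ N, 0 ≤ N ∧ v ∈ V.tail N ∧
      f.toFun (tw.t v (F.x 0)) ∈ tw'.level N := by
    intro v
    obtain ⟨N, hN⟩ := hV.exists_mem_tail v
    obtain ⟨N', hN'⟩ := tw'.exists_mem_level hV' (f.toFun (tw.t v (F.x 0)))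
    exact ⟨max 0 (max N N'), le_max_left _ _,
      V.tail_mono ((le_max_left _ _).trans (le_max_right _ _)) hN,
      tw'.level_mono ((le_max_right _ _).trans (le_max_right _ _)) hN'⟩
  obtain rfl : b = b' := by
    obtain ⟨N, hN, hv, hf⟩ := hlev u
    exact eq_b_of_injective tw tw' F F' f hinj hb hb' hN hv hf hV.ne_zero
  have h2 : (2 - 2 * b) ≠ 0 := fun h0 => hb (by linear_combination (-1 / 2) * h0)
  obtain ⟨g, hg⟩ : ∃ g : V.carrier →ₗ[ℂ] V'.carrier,
      ∀ v, g v = tw'.coeff (F'.xCoord 0) (f.toFun (tw.t v (F.x 0))) :=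
    ⟨(tw'.coeff (F'.xCoord 0)).comp (f.toFun.comp (tw.t.flip (F.x 0))), fun v => rfl⟩
  have hoff : ∀ v l, tw'.coeff (F'.xCoord l) (f.toFun (tw.t v (F.x 0))) ≠ 0 →
      a = a' ∧ l = 0 := by
    intro v l hl
    obtain ⟨N, hN, hv, hf⟩ := hlev v
    have e := (smul_eq_zero.1 (smul_xCoeff_map_eq_zero tw tw' F F' f hb hN hv hf l)).resolve_right
      hl
    have hre : a'.re + l - a.re = 0 := by simpa using congrArg Complex.re e
    have hl0 : l = 0 := by
      have h1 : ((l : ℤ) : ℝ) < 1 := by linarith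
      have h2 : (-1 : ℝ) < l := by linarith
      norm_cast at h1
      have h3 : -1 < l := by exact_mod_cast h2
      omega
    subst hl0
    exact ⟨by simpa [sub_eq_zero, eq_comm] using e, rfl⟩
  have hlim : ∀ v, ∃ M : ℤ, ∀ s, M ≤ s →
      f.toFun (tw.t v (F.x s)) = tw'.t (g v) (F'.x s) := by
    intro v
    obtain ⟨N, hN, hv, hf⟩ := hlev v
    refine ⟨2 * N + 3, fun s hs => tw'.ext_coeff F' (fun l => ?_) (fun l => ?_)⟩
    · obtain ⟨l, rfl⟩ : ∃ m, l = m + s := ⟨l - s, by ring⟩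
      have x1 := xCoeff_map_t_x tw tw' F F' f hv hf (s := s) (by omega) l
      replace x1 := smul_right_injective _ h2 x1
      rw [zero_add] at x1
      rw [x1, tw'.coeff_t, F'.xCoord_x, hg]
      by_cases hl : l = 0
      · subst hl
        simp
      · rw [if_neg (by omega), zero_smul]
        by_contra hne
        exact hl (hoff v l hne).2
    · have := yCoeff_map_t_x_eq_zero tw tw' F F' f hb hb hv hf hs l
      rw [zero_add] at this
      rw [this, tw'.coeff_t, F'.yCoord_x, zero_smul]
  have hginj : Function.Injective g := by
    rw [← LinearMap.ker_eq_bot, Submodule.eq_bot_iff]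
    intro v hv
    rw [LinearMap.mem_ker] at hv
    obtain ⟨M, hM⟩ := hlim v
    have h0 := hM M le_rfl
    rw [hv, map_zero, LinearMap.zero_apply, ← map_zero f.toFun] at h0
    have := tw.coeff_t (F.xCoord M) v (F.x M)
    rw [hinj h0, map_zero, F.xCoord_x, if_pos rfl, one_smul] at this
    exact this.symm
  obtain rfl : a = a' := by
    refine (hoff u 0 ?_).1
    rw [← hg]
    exact fun h0 => hV.ne_zero (hginj (by rw [h0, map_zero]))
  obtain ⟨φ, rfl⟩ := exists_hom_of_eventually tw tw' F F' f hV.exists_mem_tail hV'.exists_mem_tail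
    g hlim
  obtain ⟨hc, hh⟩ := hV.eq_of_injective hV' hs' φ hginj
  exact ⟨hc, hh, rfl, rfl⟩

/-- Simple highest weight modules of the same highest weight are isomorphic, compatibly with
the grading. -/
theorem IsHW.exists_iso {V V' : NSMod c} {u : V.carrier} {u' : V'.carrier} (hV : IsHW h V u)
    (hs : V.IsSimple) (hV' : IsHW h V' u') (hs' : V'.IsSimple) :
    ∃ g : NSHom V V', Function.Bijective g.toFun ∧ ∀ v, V'.sgn (g.toFun v) = g.toFun (V.sgn v) := by
  obtain ⟨g, hg⟩ := hV.exists_hom hV' hs'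
  obtain ⟨k, hk⟩ := hV'.exists_hom hV hs
  let kg : NSHom V V := ⟨k.toFun.comp g.toFun, fun m v => by simp [g.commL, k.commL],
    fun m v => by simp [g.commG, k.commG]⟩
  let gk : NSHom V' V' := ⟨g.toFun.comp k.toFun, fun m v => by simp [g.commL, k.commL],
    fun m v => by simp [g.commG, k.commG]⟩
  let g' : NSHom V V' := ⟨V'.sgn.comp (g.toFun.comp V.sgn),
    fun m v => by simp [V.sgn_L, V'.sgn_L, g.commL], fun m v => by simp [V.sgn_G, V'.sgn_G, g.commG]⟩
  have h1 : kg.toFun = LinearMap.id :=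
    hV.hom_ext kg ⟨LinearMap.id, fun _ _ => rfl, fun _ _ => rfl⟩ (by simp [kg, hg, hk])
  have h2 : gk.toFun = LinearMap.id :=
    hV'.hom_ext gk ⟨LinearMap.id, fun _ _ => rfl, fun _ _ => rfl⟩ (by simp [gk, hg, hk])
  have h3 : g.toFun = g'.toFun := hV.hom_ext g g'
    (by simp [g', V.sgn_even hV.mem_even, hg, V'.sgn_even hV'.mem_even])
  refine ⟨g, Function.bijective_iff_has_inverse.2
    ⟨k.toFun, LinearMap.congr_fun h1, LinearMap.congr_fun h2⟩, fun v => ?_⟩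
  have := LinearMap.congr_fun h3 v
  rw [this]
  simp [g', V'.sgn_sgn]

theorem TensorWitness.iso_of_iso {V V' : NSMod c} {T T' : NSMod c} (tw : TensorWitness V S T)
    (tw' : TensorWitness V' S' T') (g : NSHom V V') (hg : Function.Bijective g.toFun)
    (hsgn : ∀ v, V'.sgn (g.toFun v) = g.toFun (V.sgn v)) (k : NSHom S S')
    (hk : Function.Bijective k.toFun) : NSIso T T' := by
  let e : T.carrier ≃ₗ[ℂ] T'.carrier := tw.isTensor.equiv.symm.trans
    ((TensorProduct.congr (LinearEquiv.ofBijective g.toFun hg)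
      (LinearEquiv.ofBijective k.toFun hk)).trans tw'.isTensor.equiv)
  have he : ∀ v s, e (tw.t v s) = tw'.t (g.toFun v) (k.toFun s) := fun v s => by
    simp [e, IsTensorProduct.equiv_symm_apply]
  have ext : ∀ {p q : T.carrier →ₗ[ℂ] T'.carrier}, (∀ v s, p (tw.t v s) = q (tw.t v s)) →
      ∀ z, p z = q z := fun hpq z =>
    tw.isTensor.inductionOn z (by simp) hpq fun z w hz hw => by rw [map_add, map_add, hz, hw]
  refine ⟨⟨e.toLinearMap, fun m z => ?_, fun m z => ?_⟩, e.bijective⟩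
  · refine ext (p := e.toLinearMap.comp (T.L m)) (q := (T'.L m).comp e.toLinearMap) (fun v s => ?_) z
    simp [tw.actL, tw'.actL, he, g.commL, k.commL]
  · refine ext (p := e.toLinearMap.comp (T.G m)) (q := (T'.G m).comp e.toLinearMap) (fun v s => ?_) z
    simp [tw.actG, tw'.actG, he, g.commG, k.commG, hsgn]

end Comparison

/-- Theorem 4.1: for simple highest weight modules `V`,
`V₁` of highest weights `(c,h)`, `(c₁,h₁)` and intermediate series modules
`SA'_{a,b}`, `SA'_{a₁,b₁}` (with `0 ≤ Re a, Re a₁ < 1`, `b, b₁ ≠ 1`),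
`V ⊗ SA'_{a,b} ≅ V₁ ⊗ SA'_{a₁,b₁}` if and only if `c = c₁`, `h = h₁`,
`a = a₁` and `b = b₁`. -/
theorem tensor_iso_iff_parameters (a b c h a₁ b₁ c₁ h₁ : ℂ)
    (ha0 : 0 ≤ a.re) (ha1 : a.re < 1) (hb : b ≠ 1)
    (ha₁0 : 0 ≤ a₁.re) (ha₁1 : a₁.re < 1) (hb₁ : b₁ ≠ 1)
    (V : NSMod c) (u : V.carrier) (hV : IsHW h V u) (hVs : V.IsSimple)
    (V₁ : NSMod c₁) (u₁ : V₁.carrier) (hV₁ : IsHW h₁ V₁ u₁) (hV₁s : V₁.IsSimple)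
    (S : NSMod 0) (F : SA'Family a b S)
    (S₁ : NSMod 0) (F₁ : SA'Family a₁ b₁ S₁)
    (T : NSMod c) (tw : TensorWitness V S T)
    (T₁ : NSMod c₁) (tw₁ : TensorWitness V₁ S₁ T₁) :
    NSIso T T₁ ↔ (c = c₁ ∧ h = h₁ ∧ a = a₁ ∧ b = b₁) := by
  constructor
  · rintro ⟨f, hf⟩
    exact parameters_eq_of_injective ha0 ha1 hb ha₁0 ha₁1 hb₁ hV hV₁ hV₁s F F₁ tw tw₁ f hf.1
  · rintro ⟨rfl, rfl, rfl, rfl⟩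
    obtain ⟨g, hg, hsgn⟩ := hV.exists_iso hVs hV₁ hV₁s
    obtain ⟨k, hk⟩ := F.exists_iso F₁
    exact tw.iso_of_iso tw₁ g hg hsgn k hk
end
end

section
/- Let c, h, a, b, c₁, h₁, a₁, b₁ ∈ ℂ with 0 ≤ Re(a) < 1, 0 ≤ Re(a₁) < 1, b ≠ 1 and b₁ ≠ 1. Let V be a highest weight module over the Neveu–Schwarz algebra with highest weight (c, h) (not necessarily simple) and let V₁ be a highest weight module with highest weight (c₁, h₁). Then V ⊗ SA'_{a,b} and V₁ ⊗ SA'_{a₁,b₁} are isomorphic as Neveu–Schwarz modules if and only if V ≅ V₁ and SA'_{a,b} ≅ SA'_{a₁,b₁}. -/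
noncomputable section

open Submodule

namespace NSMod

variable {c : ℂ} (V : NSMod c)

/-- The projection onto the even part. -/
def evenProj : V.carrier →ₗ[ℂ] V.carrier := Submodule.projection V.even V.odd V.compl

/-- The projection onto the odd part. -/
def oddProj : V.carrier →ₗ[ℂ] V.carrier := Submodule.projection V.odd V.even V.compl.symm

/-- The parity involution: `1` on the even part and `-1` on the odd part. -/
def parity : V.carrier →ₗ[ℂ] V.carrier := V.evenProj - V.oddProj

lemma evenProj_mem (v : V.carrier) : V.evenProj v ∈ V.even :=
  Submodule.projection_apply_mem _ _

lemma oddProj_mem (v : V.carrier) : V.oddProj v ∈ V.odd :=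
  Submodule.projection_apply_mem _ _

lemma evenProj_add_oddProj (v : V.carrier) : V.evenProj v + V.oddProj v = v :=
  Submodule.projection_add_projection_eq_self V.compl v

variable {V}

lemma evenProj_of_even {v : V.carrier} (hv : v ∈ V.even) : V.evenProj v = v :=
  Submodule.projection_apply_of_mem_left _ hv

lemma evenProj_of_odd {v : V.carrier} (hv : v ∈ V.odd) : V.evenProj v = 0 :=
  (Submodule.projection_apply_eq_zero_iff _).2 hv

lemma oddProj_of_odd {v : V.carrier} (hv : v ∈ V.odd) : V.oddProj v = v :=
  Submodule.projection_apply_of_mem_left _ hv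

lemma oddProj_of_even {v : V.carrier} (hv : v ∈ V.even) : V.oddProj v = 0 :=
  (Submodule.projection_apply_eq_zero_iff _).2 hv

lemma parity_of_even {v : V.carrier} (hv : v ∈ V.even) : V.parity v = v := by
  simp [parity, evenProj_of_even hv, oddProj_of_even hv]

lemma parity_of_odd {v : V.carrier} (hv : v ∈ V.odd) : V.parity v = -v := by
  simp [parity, evenProj_of_odd hv, oddProj_of_odd hv]

@[elab_as_elim]
lemma graded_induction {motive : V.carrier → Prop} (v : V.carrier)
    (even : ∀ v ∈ V.even, motive v) (odd : ∀ v ∈ V.odd, motive v)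
    (add : ∀ v w, motive v → motive w → motive (v + w)) : motive v := by
  rw [← V.evenProj_add_oddProj v]
  exact add _ _ (even _ (V.evenProj_mem v)) (odd _ (V.oddProj_mem v))

@[simp]
lemma parity_parity (v : V.carrier) : V.parity (V.parity v) = v := by
  induction v using graded_induction with
  | even v hv => simp [parity_of_even hv]
  | odd v hv => simp [parity_of_odd hv]
  | add v w hv hw => simp [hv, hw]

lemma parity_L (m : ℤ) (v : V.carrier) : V.parity (V.L m v) = V.L m (V.parity v) := by
  induction v using graded_induction with
  | even v hv => simp [parity_of_even hv, parity_of_even (V.mapsL_even m v hv)]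
  | odd v hv => simp [parity_of_odd hv, parity_of_odd (V.mapsL_odd m v hv)]
  | add v w hv hw => simp [hv, hw]

lemma parity_G (k : ℤ) (v : V.carrier) : V.parity (V.G k v) = -V.G k (V.parity v) := by
  induction v using graded_induction with
  | even v hv => simp [parity_of_even hv, parity_of_odd (V.mapsG_even k v hv)]
  | odd v hv => simp [parity_of_odd hv, parity_of_even (V.mapsG_odd k v hv)]
  | add v w hv hw => simp [hv, hw, add_comm]

lemma L_zero_L (m : ℤ) (v : V.carrier) :
    V.L 0 (V.L m v) = V.L m (V.L 0 v) + (m : ℂ) • V.L m v := by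
  have h := V.rel_LL 0 m v
  simp only [zero_add, Int.cast_zero, sub_zero] at h
  rw [sub_eq_iff_eq_add] at h
  rw [h]
  split_ifs with hm
  · simp [hm]
  · simp [add_comm]

lemma L_zero_G (k : ℤ) (v : V.carrier) :
    V.L 0 (V.G k v) = V.G k (V.L 0 v) + ((k : ℂ) + 1 / 2) • V.G k v := by
  have h := V.rel_LG 0 k v
  simp only [zero_add, Int.cast_zero, zero_div, sub_zero] at h
  rw [← h]; abel

/-- Every vector of a highest weight module is annihilated by all modes of large index. -/
lemma eventually_annihilated {h : ℂ} {u : V.carrier} (hV : IsHW h V u) (v : V.carrier) :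
    ∃ K : ℤ, ∀ m, K ≤ m → V.L m v = 0 ∧ V.G m v = 0 := by
  let W : Submodule ℂ V.carrier :=
    { carrier := {v | ∃ K : ℤ, ∀ m, K ≤ m → V.L m v = 0 ∧ V.G m v = 0}
      add_mem' := by
        rintro v w ⟨K, hK⟩ ⟨K', hK'⟩
        refine ⟨max K K', fun m hm => ?_⟩
        have h1 := hK m (le_trans (le_max_left _ _) hm)
        have h2 := hK' m (le_trans (le_max_right _ _) hm)
        simp [h1, h2]
      zero_mem' := ⟨0, by simp⟩
      smul_mem' := by
        rintro r v ⟨K, hK⟩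
        exact ⟨K, fun m hm => by simp [hK m hm]⟩ }
  have hW : V.IsSubmodule W := by
    constructor
    · rintro i v ⟨K, hK⟩
      refine ⟨max K (max (K - i) (1 - i)), fun m hm => ?_⟩
      simp only [max_le_iff] at hm
      have h1 := V.rel_LL m i v
      have h2 := V.rel_LG i m v
      rw [if_neg (by omega), (hK m hm.1).1, (hK (m + i) (by omega)).1] at h1
      rw [(hK m hm.1).2, (hK (i + m) (by omega)).2] at h2
      constructor
      · simpa using h1
      · simpa using h2
    · rintro i v ⟨K, hK⟩
      refine ⟨max K (max (K - i) (-i)), fun m hm => ?_⟩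
      simp only [max_le_iff] at hm
      have h1 := V.rel_LG m i v
      have h2 := V.rel_GG m i v
      rw [(hK m hm.1).1, (hK (m + i) (by omega)).2] at h1
      rw [if_neg (by omega), (hK m hm.1).2, (hK (m + i + 1) (by omega)).1] at h2
      constructor
      · simpa using h1
      · simpa using h2
  have hu : u ∈ W := ⟨1, fun m hm => ⟨hV.hwL m hm, hV.hwG m (by omega)⟩⟩
  have : v ∈ W := by rw [hV.gen W hW hu]; trivial
  exact this

end NSMod

namespace SA'Family

variable {a b : ℂ} {S : NSMod 0} (F : SA'Family a b S)

/-- The spanning vectors `x j` and `y j` as a single family. -/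
def vec : ℤ ⊕ ℤ → S.carrier := Sum.elim F.x F.y

/-- The `L₀`-weight `a + j` of `x j`, respectively `a + 1 / 2 + j` of `y j`. -/
def weight (a : ℂ) : ℤ ⊕ ℤ → ℂ := Sum.elim (fun j => a + j) (fun j => a + 1 / 2 + j)

lemma weight_injective (a : ℂ) : Function.Injective (weight a) := by
  have key : ∀ i j : ℤ, a + i ≠ a + 1 / 2 + j := by
    intro i j h
    have h2 : (2 * i : ℂ) = ((1 + 2 * j : ℤ) : ℂ) := by push_cast; linear_combination 2 * h
    have h3 : 2 * i = 1 + 2 * j := by exact_mod_cast h2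
    omega
  rintro (i | i) (j | j) h
  · simpa [weight] using h
  · exact absurd h (key i j)
  · exact absurd h.symm (key j i)
  · simpa [weight] using h

lemma L_zero_vec (p : ℤ ⊕ ℤ) : S.L 0 (F.vec p) = weight a p • F.vec p := by
  rcases p with j | j
  · simpa [vec, weight] using F.act_Lx 0 j
  · simpa [vec, weight] using F.act_Ly 0 j

lemma vec_eq_zero_iff (p : ℤ ⊕ ℤ) : F.vec p = 0 ↔ p = Sum.inr (-1) ∧ a = 1 / 2 ∧ b = 1 / 2 := by
  by_cases h : a = 1 / 2 ∧ b = 1 / 2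
  · obtain ⟨h0, hli⟩ := F.indep_special h
    rcases p with j | j
    · simpa [vec] using hli.ne_zero (Sum.inl j)
    · by_cases hj : j = -1
      · subst hj
        simpa [vec, h0] using h
      · simpa [vec, hj] using hli.ne_zero (Sum.inr ⟨j, hj⟩)
  · have := (F.indep_generic h).ne_zero p
    simp only [h, and_false, iff_false]
    exact this

lemma linearIndependent_vec :
    LinearIndependent ℂ (fun p : {p : ℤ ⊕ ℤ // F.vec p ≠ 0} => F.vec p) := by
  by_cases h : a = 1 / 2 ∧ b = 1 / 2
  · obtain ⟨h0, hli⟩ := F.indep_special h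
    have hne : ∀ j, F.vec (Sum.inr j) ≠ 0 → j ≠ -1 := by
      rintro j hj rfl
      exact hj h0
    let g : {p : ℤ ⊕ ℤ // F.vec p ≠ 0} → ℤ ⊕ {j : ℤ // j ≠ -1} := fun p =>
      match p with
      | ⟨Sum.inl j, _⟩ => Sum.inl j
      | ⟨Sum.inr j, hj⟩ => Sum.inr ⟨j, hne j hj⟩
    have hg : Function.Injective g := by
      rintro ⟨i | i, hi⟩ ⟨j | j, hj⟩ hij <;> simp_all [g]
    convert hli.comp g hg using 1
    ext ⟨i | i, hi⟩ <;> rfl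
  · exact (F.indep_generic h).comp _ Subtype.val_injective

lemma span_vec : Submodule.span ℂ (Set.range F.vec) = ⊤ := by
  rw [vec, Set.Sum.elim_range, F.spans]

/-- The nonzero vectors among the `x j` and `y j` form a basis. -/
def basis : Module.Basis {p : ℤ ⊕ ℤ // F.vec p ≠ 0} ℂ S.carrier :=
  Module.Basis.mk F.linearIndependent_vec <| by
    rw [← F.span_vec, Submodule.span_le]
    rintro _ ⟨p, rfl⟩
    by_cases hp : F.vec p = 0
    · rw [hp]; exact Submodule.zero_mem _
    · exact Submodule.subset_span ⟨⟨p, hp⟩, rfl⟩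

lemma basis_apply (p : {p : ℤ ⊕ ℤ // F.vec p ≠ 0}) : F.basis p = F.vec p := by
  simp [basis]

lemma hom_ext {M : Type*} [AddCommGroup M] [Module ℂ M] {f g : S.carrier →ₗ[ℂ] M}
    (h : ∀ p, f (F.vec p) = g (F.vec p)) : f = g :=
  LinearMap.ext_on F.span_vec (by rintro _ ⟨p, rfl⟩; exact h p)

open Classical in
/-- The coordinate functional of `F.vec p` (zero if this vector vanishes). -/
def coord (p : ℤ ⊕ ℤ) : S.carrier →ₗ[ℂ] ℂ :=
  if hp : F.vec p ≠ 0 then F.basis.coord ⟨p, hp⟩ else 0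

variable {F} in
lemma coord_vec_self {p : ℤ ⊕ ℤ} (hp : F.vec p ≠ 0) : F.coord p (F.vec p) = 1 := by
  rw [coord, dif_pos hp, ← F.basis_apply ⟨p, hp⟩]
  simp

variable {F} in
lemma coord_vec_ne {p q : ℤ ⊕ ℤ} (h : p ≠ q) : F.coord p (F.vec q) = 0 := by
  rw [coord]
  split_ifs with hp
  · by_cases hq : F.vec q = 0
    · simp [hq]
    · rw [← F.basis_apply ⟨q, hq⟩]
      simp [h.symm]
  · rfl

lemma coord_L_zero (p : ℤ ⊕ ℤ) (s : S.carrier) :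
    F.coord p (S.L 0 s) = weight a p * F.coord p s := by
  have : F.coord p ∘ₗ S.L 0 = weight a p • F.coord p := by
    refine F.hom_ext fun q => ?_
    by_cases h : p = q
    · subst h; simp [L_zero_vec]
    · simp [L_zero_vec, coord_vec_ne h]
  exact LinearMap.congr_fun this s

lemma coord_eq_zero_of_eigen {p : ℤ ⊕ ℤ} {s : S.carrier} {μ : ℂ} (hs : S.L 0 s = μ • s)
    (hμ : μ ≠ weight a p) : F.coord p s = 0 := by
  have h := F.coord_L_zero p s
  rw [hs, map_smul, smul_eq_mul] at h
  have h' : (μ - weight a p) * F.coord p s = 0 := by linear_combination h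
  exact (mul_eq_zero.1 h').resolve_left (sub_ne_zero.2 hμ)

lemma G_x_vec (i j : ℤ) : S.G i (F.vec (Sum.inl j)) = F.vec (Sum.inr (i + j)) := F.act_Gx i j

lemma G_y_vec (i j : ℤ) : S.G i (F.vec (Sum.inr j)) =
    (a + 1 / 2 + (j : ℂ) + (2 * (i : ℂ) + 1) * (b - 1 / 2)) • F.vec (Sum.inl (i + j + 1)) :=
  F.act_Gy i j

lemma L_x_vec (i j : ℤ) : S.L i (F.vec (Sum.inl j)) =
    (a + (j : ℂ) + (i : ℂ) * b) • F.vec (Sum.inl (i + j)) := F.act_Lx i j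

lemma L_y_vec (i j : ℤ) : S.L i (F.vec (Sum.inr j)) =
    (a + 1 / 2 + (j : ℂ) + (i : ℂ) * (b - 1 / 2)) • F.vec (Sum.inr (i + j)) := F.act_Ly i j

/-- The polynomial dependence of `G_{N-k} L_k` on `k`, extrapolated to `k = 0`. -/
lemma G_L_zero (F : SA'Family a b S) (N k : ℤ) (s : S.carrier) :
    S.G N (S.L 0 s) = (3 : ℂ) • S.G (N - k) (S.L k s)
      - (3 : ℂ) • S.G (N - 2 * k) (S.L (2 * k) s) + S.G (N - 3 * k) (S.L (3 * k) s) := by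
  have : S.G N ∘ₗ S.L 0 = (3 : ℂ) • (S.G (N - k) ∘ₗ S.L k)
      - (3 : ℂ) • (S.G (N - 2 * k) ∘ₗ S.L (2 * k)) + S.G (N - 3 * k) ∘ₗ S.L (3 * k) := by
    refine F.hom_ext fun p => ?_
    rcases p with j | j
    · simp only [LinearMap.comp_apply, LinearMap.add_apply, LinearMap.sub_apply,
        LinearMap.smul_apply, L_x_vec, map_smul, G_x_vec]
      rw [show N + (0 + j) = N + j by ring, show N - k + (k + j) = N + j by ring,
        show N - 2 * k + (2 * k + j) = N + j by ring, show N - 3 * k + (3 * k + j) = N + j by ring]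
      push_cast
      module
    · simp only [LinearMap.comp_apply, LinearMap.add_apply, LinearMap.sub_apply,
        LinearMap.smul_apply, L_y_vec, map_smul, G_y_vec]
      rw [show N + (0 + j) + 1 = N + j + 1 by ring, show N - k + (k + j) + 1 = N + j + 1 by ring,
        show N - 2 * k + (2 * k + j) + 1 = N + j + 1 by ring,
        show N - 3 * k + (3 * k + j) + 1 = N + j + 1 by ring]
      push_cast
      module
  exact LinearMap.congr_fun this s

/-- For large `N`, each coordinate functional is recovered from `G_N`. -/
lemma exists_coord_comp_G (ha0 : 0 ≤ a.re) (ha1 : a.re < 1) {p : ℤ ⊕ ℤ}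
    (hp : F.vec p ≠ 0) (K : ℤ) :
    ∃ N, K ≤ N ∧ ∃ q, ∃ r : ℂ, r ≠ 0 ∧ F.coord q ∘ₗ S.G N = r • F.coord p := by
  rcases p with j | j
  · refine ⟨max K (-j), le_max_left _ _, Sum.inr (max K (-j) + j), 1, one_ne_zero, ?_⟩
    have hN : -j ≤ max K (-j) := le_max_right _ _
    generalize max K (-j) = N at hN
    refine F.hom_ext ?_
    rintro (i | i)
    · by_cases hij : i = j
      · subst hij
        have h1 : F.vec (Sum.inr (N + i)) ≠ 0 := by
          rw [Ne, vec_eq_zero_iff]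
          rintro ⟨h, -⟩
          have := Sum.inr.inj h
          omega
        simp [G_x_vec, coord_vec_self h1, coord_vec_self hp]
      · rw [LinearMap.comp_apply, G_x_vec, coord_vec_ne (by simpa using Ne.symm hij)]
        simp [coord_vec_ne (F := F) (p := Sum.inl j) (q := Sum.inl i) (by simpa using Ne.symm hij)]
    · simp [G_y_vec, coord_vec_ne]
  · obtain ⟨N, hN, hr⟩ : ∃ N, K ≤ N ∧
        a + 1 / 2 + (j : ℂ) + (2 * (N : ℂ) + 1) * (b - 1 / 2) ≠ 0 := by
      by_contra! H
      have h0 := H K le_rfl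
      have h1 := H (K + 1) (by omega)
      push_cast at h1
      have hb : b = 1 / 2 := by linear_combination (h1 - h0) / 2
      subst hb
      have ha : a = -1 / 2 - j := by linear_combination h0
      have hre := congrArg Complex.re ha
      norm_num at hre
      have hj : j = -1 := by
        have h2 : -2 < j := by
          have : (-2 : ℝ) < j := by linarith
          exact_mod_cast this
        have h3 : j < 0 := by
          have : (j : ℝ) < 0 := by linarith
          exact_mod_cast this
        omega
      subst hj
      refine hp ((F.vec_eq_zero_iff _).2 ⟨rfl, ?_, rfl⟩)
      rw [ha]; norm_num
    refine ⟨N, hN, Sum.inl (N + j + 1), _, hr, ?_⟩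
    refine F.hom_ext ?_
    rintro (i | i)
    · simp [G_x_vec, coord_vec_ne]
    · by_cases hij : i = j
      · subst hij
        have h1 : F.vec (Sum.inl (N + i + 1)) ≠ 0 := by
          simp [vec_eq_zero_iff]
        simp [G_y_vec, coord_vec_self h1, coord_vec_self hp]
      · have h1 : Sum.inl (β := ℤ) (N + j + 1) ≠ Sum.inl (N + i + 1) := by
          simpa using Ne.symm hij
        have h2 : Sum.inr (α := ℤ) j ≠ Sum.inr i := by
          simpa using Ne.symm hij
        simp [G_y_vec, coord_vec_ne h1, coord_vec_ne h2]

end SA'Family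

namespace TensorWitness

variable {c : ℂ} {V : NSMod c} {S : NSMod 0} {T : NSMod c} (tw : TensorWitness V S T)

lemma hom_ext {M : Type*} [AddCommGroup M] [Module ℂ M] {f g : T.carrier →ₗ[ℂ] M}
    (h : ∀ v s, f (tw.t v s) = g (tw.t v s)) : f = g := by
  ext z
  induction z using tw.isTensor.inductionOn with
  | zero => simp
  | tmul v s => exact h v s
  | add z w hz hw => simp [hz, hw]

lemma actG_s19 (k : ℤ) (v : V.carrier) (s : S.carrier) :
    T.G k (tw.t v s) = tw.t (V.G k v) s + tw.t (V.parity v) (S.G k s) := by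
  induction v using NSMod.graded_induction with
  | even v hv => rw [tw.actG_even k v hv, NSMod.parity_of_even hv]
  | odd v hv => rw [tw.actG_odd k v hv, NSMod.parity_of_odd hv]; simp [sub_eq_add_neg]
  | add v w hv hw =>
    simp only [map_add, LinearMap.add_apply, hv, hw]
    abel

/-- Contraction of the second tensor factor with a linear functional. -/
def contract (φ : S.carrier →ₗ[ℂ] ℂ) : T.carrier →ₗ[ℂ] V.carrier :=
  tw.isTensor.lift (LinearMap.lsmul ℂ V.carrier ∘ₗ φ).flip

@[simp]
lemma contract_t (φ : S.carrier →ₗ[ℂ] ℂ) (v : V.carrier) (s : S.carrier) :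
    tw.contract φ (tw.t v s) = φ s • v := by
  simp [contract, tw.isTensor.lift_eq]

lemma contract_smul (r : ℂ) (φ : S.carrier →ₗ[ℂ] ℂ) (z : T.carrier) :
    tw.contract (r • φ) z = r • tw.contract φ z := by
  have : tw.contract (r • φ) = r • tw.contract φ := tw.hom_ext fun v s => by simp [mul_smul]
  rw [this, LinearMap.smul_apply]

/-- The action of `L₀` on the second tensor factor. -/
def rightWeight : T.carrier →ₗ[ℂ] T.carrier := tw.isTensor.lift (tw.t.compl₂ (S.L 0))

@[simp]
lemma rightWeight_t (v : V.carrier) (s : S.carrier) :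
    tw.rightWeight (tw.t v s) = tw.t v (S.L 0 s) := by
  simp [rightWeight, tw.isTensor.lift_eq]

section Family

variable {a b : ℂ} (F : SA'Family a b S)

lemma eq_zero_of_contract {z : T.carrier} (h : ∀ p, F.vec p ≠ 0 → tw.contract (F.coord p) z = 0) :
    z = 0 := by
  let e := tw.isTensor.equiv.symm ≪≫ₗ TensorProduct.equivFinsuppOfBasisRight F.basis
  apply e.injective
  rw [map_zero]
  ext p
  have : Finsupp.lapply p ∘ₗ e.toLinearMap = tw.contract (F.coord p) := by
    refine tw.hom_ext fun v s => ?_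
    simp [e, SA'Family.coord, p.2]
  rw [Finsupp.zero_apply, ← h p p.2, ← this]
  rfl

lemma contract_rightWeight (p : ℤ ⊕ ℤ) (z : T.carrier) :
    tw.contract (F.coord p) (tw.rightWeight z)
      = SA'Family.weight a p • tw.contract (F.coord p) z := by
  have : tw.contract (F.coord p) ∘ₗ tw.rightWeight
      = SA'Family.weight a p • tw.contract (F.coord p) :=
    tw.hom_ext fun v s => by simp [F.coord_L_zero, mul_smul]
  exact LinearMap.congr_fun this z

lemma contract_eq_zero_of_eigen {z : T.carrier} {μ : ℂ} (hz : tw.rightWeight z = μ • z)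
    {p : ℤ ⊕ ℤ} (hμ : μ ≠ SA'Family.weight a p) : tw.contract (F.coord p) z = 0 := by
  have h := tw.contract_rightWeight F p z
  rw [hz, map_smul, ← sub_eq_zero, ← sub_smul] at h
  exact (smul_eq_zero.1 h).resolve_left (sub_ne_zero.2 hμ)

/-- An eigenvector for the right weight is a pure tensor. -/
lemma eq_t_of_eigen {z : T.carrier} {p : ℤ ⊕ ℤ}
    (hz : tw.rightWeight z = SA'Family.weight a p • z) :
    z = tw.t (tw.contract (F.coord p) z) (F.vec p) := by
  rw [← sub_eq_zero]
  refine tw.eq_zero_of_contract F fun q hq => ?_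
  rw [map_sub, contract_t]
  by_cases h : q = p
  · subst h
    simp [SA'Family.coord_vec_self hq]
  · rw [SA'Family.coord_vec_ne h, zero_smul, sub_zero]
    exact tw.contract_eq_zero_of_eigen F hz
      fun h' => h (SA'Family.weight_injective a h'.symm)

lemma t_eq_zero_iff {v : V.carrier} {p : ℤ ⊕ ℤ} (hp : F.vec p ≠ 0) :
    tw.t v (F.vec p) = 0 ↔ v = 0 := by
  constructor
  · intro h
    have := tw.contract_t (F.coord p) v (F.vec p)
    rw [h, SA'Family.coord_vec_self hp] at this
    simpa using this.symm
  · rintro rfl; simp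

variable {h : ℂ} {u : V.carrier}

lemma contract_G (hV : IsHW h V u) (z : T.carrier) : ∃ K, ∀ N, K ≤ N → ∀ φ : S.carrier →ₗ[ℂ] ℂ,
    tw.contract φ (T.G N z) = V.parity (tw.contract (φ ∘ₗ S.G N) z) := by
  induction z using tw.isTensor.inductionOn with
  | zero => exact ⟨0, by simp⟩
  | tmul v s =>
    obtain ⟨K, hK⟩ := NSMod.eventually_annihilated hV v
    exact ⟨K, fun N hN φ => by simp [actG_s19, hK N hN]⟩
  | add z w hz hw =>
    obtain ⟨K, hK⟩ := hz
    obtain ⟨K', hK'⟩ := hw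
    refine ⟨max K K', fun N hN φ => ?_⟩
    rw [map_add, map_add, map_add, hK N (le_trans (le_max_left _ _) hN),
      hK' N (le_trans (le_max_right _ _) hN), map_add]

lemma eq_zero_of_G (tw : TensorWitness V S T) (F : SA'Family a b S)
    (hV : IsHW h V u) (ha0 : 0 ≤ a.re) (ha1 : a.re < 1) {z : T.carrier}
    (hz : ∃ K, ∀ N, K ≤ N → T.G N z = 0) : z = 0 := by
  obtain ⟨K, hK⟩ := hz
  obtain ⟨K', hK'⟩ := tw.contract_G hV z
  refine tw.eq_zero_of_contract F fun p hp => ?_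
  obtain ⟨N, hN, q, r, hr, hq⟩ := F.exists_coord_comp_G ha0 ha1 hp (max K K')
  have h1 := hK' N (le_trans (le_max_right _ _) hN) (F.coord q)
  rw [hK N (le_trans (le_max_left _ _) hN), map_zero, hq, contract_smul] at h1
  have h2 := congrArg V.parity h1
  rw [NSMod.parity_parity, map_zero] at h2
  exact (smul_eq_zero.1 h2.symm).resolve_left hr

/-- The right weight is determined by the action of modes of large index. -/
lemma G_rightWeight (F : SA'Family a b S) (hV : IsHW h V u) (z : T.carrier) :
    ∃ K, ∀ k, K ≤ k → ∀ N, 4 * k ≤ N → T.G N (tw.rightWeight z) = (3 : ℂ) • T.G (N - k) (T.L k z)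
      - (3 : ℂ) • T.G (N - 2 * k) (T.L (2 * k) z) + T.G (N - 3 * k) (T.L (3 * k) z) := by
  induction z using tw.isTensor.inductionOn with
  | zero => exact ⟨0, by simp⟩
  | tmul v s =>
    obtain ⟨K, hK⟩ := NSMod.eventually_annihilated hV v
    refine ⟨max K 0, fun k hk N hN => ?_⟩
    rw [max_le_iff] at hk
    have hL : ∀ m, k ≤ m → V.L m v = 0 := fun m hm => (hK m (by omega)).1
    have hG : ∀ m, k ≤ m → V.G m v = 0 := fun m hm => (hK m (by omega)).2
    simp only [rightWeight_t, actL, actG_s19, hL k le_rfl, hL (2 * k) (by omega),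
      hL (3 * k) (by omega), hG N (by omega), hG (N - k) (by omega), hG (N - 2 * k) (by omega),
      hG (N - 3 * k) (by omega), map_zero, LinearMap.zero_apply, zero_add]
    rw [F.G_L_zero N k s]
    simp only [map_add, map_sub, map_smul]
  | add z w hz hw =>
    obtain ⟨K, hK⟩ := hz
    obtain ⟨K', hK'⟩ := hw
    refine ⟨max K K', fun k hk N hN => ?_⟩
    simp only [map_add, hK k (le_trans (le_max_left _ _) hk) N hN,
      hK' k (le_trans (le_max_right _ _) hk) N hN, smul_add]
    abel

end Family

end TensorWitness

/-- Homomorphisms between the tensor products commute with the right weights. -/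
lemma NSHom.map_rightWeight {c h a b c₁ h₁ a₁ b₁ : ℂ}
    (ha₁0 : 0 ≤ a₁.re) (ha₁1 : a₁.re < 1)
    {V : NSMod c} {u : V.carrier} (hV : IsHW h V u)
    {V₁ : NSMod c₁} {u₁ : V₁.carrier} (hV₁ : IsHW h₁ V₁ u₁)
    {S : NSMod 0} (F : SA'Family a b S) {S₁ : NSMod 0} (F₁ : SA'Family a₁ b₁ S₁)
    {T : NSMod c} (tw : TensorWitness V S T) {T₁ : NSMod c₁} (tw₁ : TensorWitness V₁ S₁ T₁)
    (f : NSHom T T₁) (z : T.carrier) :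
    f.toFun (tw.rightWeight z) = tw₁.rightWeight (f.toFun z) := by
  rw [← sub_eq_zero]
  obtain ⟨K, hK⟩ := tw.G_rightWeight F hV z
  obtain ⟨K', hK'⟩ := tw₁.G_rightWeight F₁ hV₁ (f.toFun z)
  refine tw₁.eq_zero_of_G F₁ hV₁ ha₁0 ha₁1 ⟨4 * max K K', fun N hN => ?_⟩
  rw [map_sub, ← f.commG, hK _ (le_max_left K K') N hN, hK' _ (le_max_right K K') N hN]
  simp only [map_add, map_sub, map_smul, f.commG, f.commL, sub_self]

/-- Intermediate series modules with the same parameters are isomorphic. -/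
lemma SA'Family.exists_hom {a b : ℂ} {S S₁ : NSMod 0} (F : SA'Family a b S)
    (F₁ : SA'Family a b S₁) :
    ∃ f : NSHom S S₁, ∀ p, f.toFun (F.vec p) = F₁.vec p := by
  let f : S.carrier →ₗ[ℂ] S₁.carrier := F.basis.constr ℂ fun p => F₁.vec p
  have hf : ∀ p, f (F.vec p) = F₁.vec p := by
    intro p
    by_cases hp : F.vec p = 0
    · rw [hp, map_zero, eq_comm, vec_eq_zero_iff, ← F.vec_eq_zero_iff, hp]
    · rw [← F.basis_apply ⟨p, hp⟩]
      exact F.basis.constr_basis ℂ _ _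
  refine ⟨⟨f, fun m v => ?_, fun k v => ?_⟩, hf⟩
  · refine LinearMap.congr_fun (f := f ∘ₗ S.L m) (g := S₁.L m ∘ₗ f) (F.hom_ext ?_) v
    rintro (j | j) <;> simp [L_x_vec, L_y_vec, hf]
  · refine LinearMap.congr_fun (f := f ∘ₗ S.G k) (g := S₁.G k ∘ₗ f) (F.hom_ext ?_) v
    rintro (j | j) <;> simp [G_x_vec, G_y_vec, hf]

lemma SA'Family.iso {a b : ℂ} {S S₁ : NSMod 0} (F : SA'Family a b S) (F₁ : SA'Family a b S₁) :
    NSIso S S₁ := by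
  obtain ⟨f, hf⟩ := F.exists_hom F₁
  obtain ⟨g, hg⟩ := F₁.exists_hom F
  refine ⟨f, Function.bijective_iff_has_inverse.2 ⟨g.toFun, fun s => ?_, fun s => ?_⟩⟩
  · exact LinearMap.congr_fun (f := g.toFun ∘ₗ f.toFun) (g := LinearMap.id)
      (F.hom_ext fun p => by simp [hf, hg]) s
  · exact LinearMap.congr_fun (f := f.toFun ∘ₗ g.toFun) (g := LinearMap.id)
      (F₁.hom_ext fun p => by simp [hf, hg]) s

lemma TensorWitness.G_G_t {c : ℂ} {V : NSMod c} {S : NSMod 0} {T : NSMod c}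
    (tw : TensorWitness V S T) {q : V.carrier} (hq : ∀ k, 0 ≤ k → V.G k q = 0) {k l : ℤ}
    (hk : 0 ≤ k) (hl : 0 ≤ l) (s : S.carrier) :
    T.G k (T.G l (tw.t q s)) = tw.t q (S.G k (S.G l s)) := by
  have h : V.G k (V.parity q) = 0 := by
    have := NSMod.parity_G k q
    rw [hq k hk, map_zero, zero_eq_neg] at this
    exact this
  simp [tw.actG_s19, hq l hl, h]

section TensorIso

variable {c h a b c₁ h₁ a₁ b₁ : ℂ}
  {V : NSMod c} {u : V.carrier} {V₁ : NSMod c₁} {u₁ : V₁.carrier}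
  {S : NSMod 0} {S₁ : NSMod 0} {T : NSMod c} {T₁ : NSMod c₁}

/-- An isomorphism of tensor products restricts to an isomorphism of the highest weight factors
on a common weight space of the second factors. -/
lemma exists_iso_of_weight_eq (ha₁0 : 0 ≤ a₁.re) (ha₁1 : a₁.re < 1)
    (hV : IsHW h V u) (hV₁ : IsHW h₁ V₁ u₁) (F : SA'Family a b S) (F₁ : SA'Family a₁ b₁ S₁)
    (tw : TensorWitness V S T) (tw₁ : TensorWitness V₁ S₁ T₁)
    (f : NSHom T T₁) (hf : Function.Bijective f.toFun) {p : ℤ ⊕ ℤ} (hp : F₁.vec p ≠ 0)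
    (hw : a = SA'Family.weight a₁ p) :
    ∃ g : NSHom V V₁, Function.Bijective g.toFun ∧
      ∀ v, f.toFun (tw.t v (F.vec (Sum.inl 0))) = tw₁.t (g.toFun v) (F₁.vec p) := by
  have hx : F.vec (Sum.inl 0) ≠ 0 := by simp [F.vec_eq_zero_iff]
  have hw0 : SA'Family.weight a (Sum.inl 0) = a := by simp [SA'Family.weight]
  have hcomm := NSHom.map_rightWeight ha₁0 ha₁1 hV hV₁ F F₁ tw tw₁ f
  let g : V.carrier →ₗ[ℂ] V₁.carrier :=
    tw₁.contract (F₁.coord p) ∘ₗ f.toFun ∘ₗ tw.t.flip (F.vec (Sum.inl 0))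
  have hgdef : ∀ v, g v = tw₁.contract (F₁.coord p) (f.toFun (tw.t v (F.vec (Sum.inl 0)))) :=
    fun _ => rfl
  have hg : ∀ v, f.toFun (tw.t v (F.vec (Sum.inl 0))) = tw₁.t (g v) (F₁.vec p) := by
    intro v
    refine tw₁.eq_t_of_eigen F₁ ?_
    rw [← hcomm, tw.rightWeight_t, F.L_zero_vec, map_smul, map_smul, hw0, ← hw]
  have hzero : ∀ v s μ, S.L 0 s = μ • s → μ ≠ a →
      tw₁.contract (F₁.coord p) (f.toFun (tw.t v s)) = 0 := by
    intro v s μ hs hμ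
    refine tw₁.contract_eq_zero_of_eigen F₁ (μ := μ) ?_ (hw ▸ hμ)
    rw [← hcomm, tw.rightWeight_t, hs, map_smul, map_smul]
  have hcoord : ∀ s μ, S₁.L 0 s = μ • s → μ ≠ a → F₁.coord p s = 0 := fun s μ hs hμ =>
    F₁.coord_eq_zero_of_eigen hs (hw ▸ hμ)
  have hself := SA'Family.coord_vec_self hp
  refine ⟨⟨g, fun m v => ?_, fun k v => ?_⟩, ⟨?_, fun v₁ => ?_⟩, hg⟩
  · have h1 := congrArg (tw₁.contract (F₁.coord p))
      (f.commL m (tw.t v (F.vec (Sum.inl 0))))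
    rw [hg, tw.actL, tw₁.actL] at h1
    simp only [map_add, tw₁.contract_t, ← hgdef, hself, one_smul] at h1
    by_cases hm : m = 0
    · subst hm
      rw [F.L_zero_vec, F₁.L_zero_vec, hw0, ← hw] at h1
      simp only [map_smul, ← hgdef, hself, smul_eq_mul, mul_one] at h1
      exact add_right_cancel h1
    · have hma : a + (m : ℂ) ≠ a := by simpa using hm
      rw [hzero v _ (a + m) _ hma, hcoord _ (a + m) _ hma] at h1
      · simpa using h1
      · rw [NSMod.L_zero_L, F₁.L_zero_vec, ← hw, map_smul, add_smul]
      · rw [NSMod.L_zero_L, F.L_zero_vec, hw0, map_smul, add_smul]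
  · have h1 := congrArg (tw₁.contract (F₁.coord p))
      (f.commG k (tw.t v (F.vec (Sum.inl 0))))
    rw [hg, tw.actG_s19, tw₁.actG_s19] at h1
    simp only [map_add, tw₁.contract_t, ← hgdef, hself, one_smul] at h1
    have hka : a + ((k : ℂ) + 1 / 2) ≠ a := by
      intro hk
      have h2 : ((2 * k + 1 : ℤ) : ℂ) = ((0 : ℤ) : ℂ) := by
        push_cast; linear_combination 2 * hk
      have h3 : 2 * k + 1 = 0 := by exact_mod_cast h2
      omega
    rw [hzero _ _ (a + (k + 1 / 2)) _ hka, hcoord _ (a + (k + 1 / 2)) _ hka] at h1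
    · simpa using h1
    · rw [NSMod.L_zero_G, F₁.L_zero_vec, ← hw, map_smul, ← add_smul]
    · rw [NSMod.L_zero_G, F.L_zero_vec, hw0, map_smul, ← add_smul]
  · rw [injective_iff_map_eq_zero]
    intro v hv
    have h1 := hg v
    rw [show g v = 0 from hv, map_zero, LinearMap.zero_apply] at h1
    exact (tw.t_eq_zero_iff F hx).1 ((injective_iff_map_eq_zero f.toFun).1 hf.1 _ h1)
  · obtain ⟨z, hz⟩ := hf.2 (tw₁.t v₁ (F₁.vec p))
    have hzw : tw.rightWeight z = SA'Family.weight a (Sum.inl 0) • z := by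
      apply hf.1
      rw [hcomm, map_smul, hz, tw₁.rightWeight_t, F₁.L_zero_vec, map_smul, hw0, hw]
    have h1 := tw.eq_t_of_eigen F hzw
    refine ⟨tw.contract (F.coord (Sum.inl 0)) z, ?_⟩
    change g _ = v₁
    rw [hgdef, ← h1, hz, tw₁.contract_t, hself, one_smul]

/-- Isomorphic tensor products have intermediate series factors whose weights agree. -/
lemma exists_weight_eq (ha₁0 : 0 ≤ a₁.re) (ha₁1 : a₁.re < 1)
    (hV : IsHW h V u) (hV₁ : IsHW h₁ V₁ u₁) (F : SA'Family a b S) (F₁ : SA'Family a₁ b₁ S₁)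
    (tw : TensorWitness V S T) (tw₁ : TensorWitness V₁ S₁ T₁)
    (f : NSHom T T₁) (hf : Function.Bijective f.toFun) :
    ∃ p, F₁.vec p ≠ 0 ∧ a = SA'Family.weight a₁ p := by
  by_contra! H
  have hx : F.vec (Sum.inl 0) ≠ 0 := by simp [F.vec_eq_zero_iff]
  have h0 : f.toFun (tw.t u (F.vec (Sum.inl 0))) = 0 := by
    refine tw₁.eq_zero_of_contract F₁ fun p hp => ?_
    refine tw₁.contract_eq_zero_of_eigen F₁ (μ := a) ?_ (H p hp)
    rw [← NSHom.map_rightWeight ha₁0 ha₁1 hV hV₁ F F₁ tw tw₁ f, tw.rightWeight_t, F.L_zero_vec,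
      map_smul, map_smul]
    simp [SA'Family.weight]
  have h1 := (injective_iff_map_eq_zero f.toFun).1 hf.1 _ h0
  exact hV.ne_zero ((tw.t_eq_zero_iff F hx).1 h1)

lemma factors_iso_of_tensor_iso (ha0 : 0 ≤ a.re) (ha1 : a.re < 1) (hb : b ≠ 1)
    (ha₁0 : 0 ≤ a₁.re) (ha₁1 : a₁.re < 1) (hb₁ : b₁ ≠ 1)
    (hV : IsHW h V u) (hV₁ : IsHW h₁ V₁ u₁) (F : SA'Family a b S) (F₁ : SA'Family a₁ b₁ S₁)
    (tw : TensorWitness V S T) (tw₁ : TensorWitness V₁ S₁ T₁) (hT : NSIso T T₁) :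
    NSIso V V₁ ∧ NSIso S S₁ := by
  obtain ⟨f, hf⟩ := hT
  obtain ⟨p, hp, hw⟩ := exists_weight_eq ha₁0 ha₁1 hV hV₁ F F₁ tw tw₁ f hf
  obtain ⟨g, hgbij, hg⟩ := exists_iso_of_weight_eq ha₁0 ha₁1 hV hV₁ F F₁ tw tw₁ f hf hp hw
  refine ⟨⟨g, hgbij⟩, ?_⟩
  have hqG : ∀ k, 0 ≤ k → V₁.G k (g.toFun u) = 0 := fun k hk => by
    rw [← g.commG, hV.hwG k hk, map_zero]
  have hqL : ∀ m, 1 ≤ m → V₁.L m (g.toFun u) = 0 := fun m hm => by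
    rw [← g.commL, hV.hwL m hm, map_zero]
  have hGG : ∀ k l, 0 ≤ k → 0 ≤ l →
      f.toFun (tw.t u (S.G k (S.G l (F.vec (Sum.inl 0)))))
        = tw₁.t (g.toFun u) (S₁.G k (S₁.G l (F₁.vec p))) := by
    intro k l hk hl
    rw [← tw.G_G_t hV.hwG hk hl, f.commG, f.commG, hg, tw₁.G_G_t hqG hk hl]
  have hX : ∀ n : ℤ, f.toFun (tw.t u (F.vec (Sum.inl n))) ≠ 0 := by
    intro n h0
    exact hV.ne_zero ((tw.t_eq_zero_iff F (by simp [F.vec_eq_zero_iff])).1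
      ((injective_iff_map_eq_zero f.toFun).1 hf.1 _ h0))
  have hre : ∀ n : ℕ, 0 < n → a + n ≠ 0 := by
    intro n hn h0
    have := congrArg Complex.re h0
    simp only [Complex.add_re, Complex.natCast_re, Complex.zero_re] at this
    have hn' : (0 : ℝ) < n := by exact_mod_cast hn
    linarith
  have e1 := hGG 0 1 (by norm_num) (by norm_num)
  have e2 := hGG 1 0 (by norm_num) (by norm_num)
  rcases p with j | j
  · have hj : j = 0 := by
      have := congrArg Complex.re hw
      simp only [SA'Family.weight, Sum.elim_inl, Complex.add_re, Complex.intCast_re] at this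
      have h1 : (j : ℝ) < 1 := by linarith
      have h2 : (-1 : ℝ) < j := by linarith
      have h1' : j < 1 := by exact_mod_cast h1
      have h2' : -1 < j := by exact_mod_cast h2
      omega
    subst hj
    have haa : a₁ = a := by rw [hw]; simp [SA'Family.weight]
    subst haa
    simp only [SA'Family.G_x_vec, SA'Family.G_y_vec, map_smul] at e1 e2
    norm_num at e1 e2
    have hX2 := hX 2
    generalize f.toFun (tw.t u (F.vec (Sum.inl 2))) = X at e1 e2 hX2
    generalize tw₁.t (g.toFun u) (F₁.vec (Sum.inl 2)) = Q at e1 e2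
    have hXQ : X = Q := by
      have h2 : (2 : ℂ) * (a₁ + (2 : ℕ)) ≠ 0 := mul_ne_zero two_ne_zero (hre 2 two_pos)
      apply smul_right_injective _ h2
      linear_combination (norm := module) (3 : ℂ) • e1 - e2
    subst hXQ
    have hbb : b₁ = b := by
      have := smul_left_injective ℂ hX2 e1
      linear_combination -this
    subst hbb
    exact F.iso F₁
  · exfalso
    have haa : a₁ + 1 / 2 + j = a := hw.symm
    have e3 := hGG 0 2 (by norm_num) (by norm_num)
    have e4 := hGG 1 1 (by norm_num) (by norm_num)
    simp only [SA'Family.G_x_vec, SA'Family.G_y_vec, map_smul, haa] at e1 e2 e3 e4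
    rw [show 0 + (1 + j + 1) = j + 2 by ring] at e1
    rw [show 1 + (0 + j + 1) = j + 2 by ring] at e2
    rw [show 0 + (2 + j + 1) = j + 3 by ring] at e3
    rw [show 1 + (1 + j + 1) = j + 3 by ring] at e4
    norm_num at e1 e2 e3 e4
    have hb0 : 1 - b ≠ 0 := sub_ne_zero.2 hb.symm
    have h2b : (2 : ℂ) * (1 - b) ≠ 0 := mul_ne_zero two_ne_zero hb0
    obtain ⟨r, hr⟩ : ∃ r, (1 - b) * r = b₁ - 1 / 2 := ⟨_, mul_div_cancel₀ _ hb0⟩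
    have hX2 : f.toFun (tw.t u (F.vec (Sum.inl 2))) =
        r • tw₁.t (g.toFun u) (F₁.vec (Sum.inr (j + 2))) := by
      apply smul_right_injective _ h2b
      change (2 * (1 - b)) • _ = (2 * (1 - b)) • r • _
      rw [smul_smul, mul_assoc, hr]
      linear_combination (norm := module) e1 - e2
    have hX3 : f.toFun (tw.t u (F.vec (Sum.inl 3))) =
        r • tw₁.t (g.toFun u) (F₁.vec (Sum.inr (j + 3))) := by
      apply smul_right_injective _ h2b
      change (2 * (1 - b)) • _ = (2 * (1 - b)) • r • _
      rw [smul_smul, mul_assoc, hr]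
      linear_combination (norm := module) e3 - e4
    have e5 : (a + 2 + b) • f.toFun (tw.t u (F.vec (Sum.inl 3))) =
        r • (a + 2 + (b₁ - 1 / 2)) • tw₁.t (g.toFun u) (F₁.vec (Sum.inr (j + 3))) := by
      have h1 := f.commL 1 (tw.t u (F.vec (Sum.inl 2)))
      rw [hX2, map_smul, tw.actL, tw₁.actL, hV.hwL 1 le_rfl, hqL 1 le_rfl, F.L_x_vec,
        F₁.L_y_vec, show 1 + (j + 2) = j + 3 by ring] at h1
      simp only [map_zero, LinearMap.zero_apply, zero_add, map_smul, Int.cast_add,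
        Int.cast_ofNat, Int.cast_one, one_mul, ← add_assoc, haa] at h1
      exact h1
    have hne2 := hX 2
    have hne3 := hX 3
    rw [hX2, smul_ne_zero_iff] at hne2
    rw [hX3, smul_ne_zero_iff] at hne3
    rw [hX2, smul_smul] at e1
    rw [hX3, smul_smul] at e4
    rw [hX3, smul_smul, smul_smul] at e5
    have s1 := smul_left_injective ℂ hne2.2 e1
    have s4 := smul_left_injective ℂ hne3.2 e4
    have s5 := smul_left_injective ℂ hne3.2 e5
    have hb2 : 1 - 2 * b = 0 := (mul_eq_zero.1 (by linear_combination s1 - s4 :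
      r * (1 - 2 * b) = 0)).resolve_left hne2.1
    have hbB : b - (b₁ - 1 / 2) = 0 := (mul_eq_zero.1 (by linear_combination s5 :
      r * (b - (b₁ - 1 / 2)) = 0)).resolve_left hne2.1
    exact hb₁ (by linear_combination -hb2 / 2 - hbB)

end TensorIso

section FactorsIso

variable {c c₁ : ℂ} {V : NSMod c} {V₁ : NSMod c₁} {S : NSMod 0} {S₁ : NSMod 0} {T : NSMod c}
  {T₁ : NSMod c₁}

namespace TensorWitness

variable (tw : TensorWitness V S T) (tw₁ : TensorWitness V₁ S₁ T₁)

/-- The map `v ⊗ s ↦ g v ⊗ gS s` for even `s` and `v ⊗ s ↦ σ g σ v ⊗ gS s` for odd `s`, where `σ`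
is the parity involution. The twist makes it a homomorphism even if `g` does not respect the
parity. -/
def twistedMap (g : V.carrier →ₗ[ℂ] V₁.carrier) (gS : S.carrier →ₗ[ℂ] S₁.carrier) :
    T.carrier →ₗ[ℂ] T₁.carrier :=
  tw.isTensor.map tw₁.isTensor g (gS ∘ₗ S.evenProj) +
    tw.isTensor.map tw₁.isTensor (V₁.parity ∘ₗ g ∘ₗ V.parity) (gS ∘ₗ S.oddProj)

variable {tw tw₁} {g : V.carrier →ₗ[ℂ] V₁.carrier} {gS : S.carrier →ₗ[ℂ] S₁.carrier}

lemma twistedMap_t_even (v : V.carrier) {s : S.carrier} (hs : s ∈ S.even) :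
    tw.twistedMap tw₁ g gS (tw.t v s) = tw₁.t (g v) (gS s) := by
  simp [twistedMap, IsTensorProduct.map_eq, NSMod.evenProj_of_even hs, NSMod.oddProj_of_even hs]

lemma twistedMap_t_odd (v : V.carrier) {s : S.carrier} (hs : s ∈ S.odd) :
    tw.twistedMap tw₁ g gS (tw.t v s) = tw₁.t (V₁.parity (g (V.parity v))) (gS s) := by
  simp [twistedMap, IsTensorProduct.map_eq, NSMod.evenProj_of_odd hs, NSMod.oddProj_of_odd hs]

lemma twistedMap_bijective (hg : Function.Bijective g) (hgS : Function.Bijective gS) :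
    Function.Bijective (tw.twistedMap tw₁ g gS) := by
  let e := LinearEquiv.ofBijective g hg
  let eS := LinearEquiv.ofBijective gS hgS
  have he (v) : e.symm (g v) = v := e.symm_apply_apply v
  have he' (v) : g (e.symm v) = v := e.apply_symm_apply v
  have heS (s) : eS.symm (gS s) = s := eS.symm_apply_apply s
  let K : T₁.carrier →ₗ[ℂ] T.carrier :=
    tw₁.isTensor.map tw.isTensor e.symm.toLinearMap (S.evenProj ∘ₗ eS.symm.toLinearMap) +
      tw₁.isTensor.map tw.isTensor (V.parity ∘ₗ e.symm.toLinearMap ∘ₗ V₁.parity)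
        (S.oddProj ∘ₗ eS.symm.toLinearMap)
  have hK_even (v) (s) (hs : s ∈ S.even) : K (tw₁.t v (gS s)) = tw.t (e.symm v) s := by
    simp [K, IsTensorProduct.map_eq, heS, NSMod.evenProj_of_even hs, NSMod.oddProj_of_even hs]
  have hK_odd (v) (s) (hs : s ∈ S.odd) :
      K (tw₁.t v (gS s)) = tw.t (V.parity (e.symm (V₁.parity v))) s := by
    simp [K, IsTensorProduct.map_eq, heS, NSMod.evenProj_of_odd hs, NSMod.oddProj_of_odd hs]
  have h1 : K ∘ₗ tw.twistedMap tw₁ g gS = LinearMap.id := tw.hom_ext fun v s => by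
    induction s using NSMod.graded_induction with
    | even s hs => simp [twistedMap_t_even v hs, hK_even _ s hs, he]
    | odd s hs => simp [twistedMap_t_odd v hs, hK_odd _ s hs, he]
    | add s s' hs hs' => simp only [map_add, hs, hs']
  have h2 : tw.twistedMap tw₁ g gS ∘ₗ K = LinearMap.id := tw₁.hom_ext fun v s => by
    obtain ⟨s, rfl⟩ := hgS.2 s
    induction s using NSMod.graded_induction with
    | even s hs => simp [twistedMap_t_even _ hs, hK_even _ s hs, he']
    | odd s hs => simp [twistedMap_t_odd _ hs, hK_odd _ s hs, he']
    | add s s' hs hs' => simp only [map_add, hs, hs']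
  exact Function.bijective_iff_has_inverse.2
    ⟨K, LinearMap.congr_fun h1, LinearMap.congr_fun h2⟩

end TensorWitness

lemma tensor_iso_of_factors_iso (tw : TensorWitness V S T) (tw₁ : TensorWitness V₁ S₁ T₁)
    (hV : NSIso V V₁) (hS : NSIso S S₁) : NSIso T T₁ := by
  obtain ⟨g, hg⟩ := hV
  obtain ⟨gS, hgS⟩ := hS
  let M := tw.twistedMap tw₁ g.toFun gS.toFun
  have hL (m : ℤ) : M ∘ₗ T.L m = T₁.L m ∘ₗ M := tw.hom_ext fun v s => by
    simp only [LinearMap.comp_apply, tw.actL, map_add, M]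
    induction s using NSMod.graded_induction with
    | even s hs =>
      simp only [TensorWitness.twistedMap_t_even _ hs, tw₁.actL, g.commL, gS.commL,
        TensorWitness.twistedMap_t_even _ (S.mapsL_even m s hs)]
    | odd s hs =>
      simp only [TensorWitness.twistedMap_t_odd _ hs, tw₁.actL, g.commL, gS.commL,
        TensorWitness.twistedMap_t_odd _ (S.mapsL_odd m s hs), NSMod.parity_L]
    | add s s' hs hs' =>
      simp only [map_add]
      linear_combination (norm := module) hs + hs'
  have hG (k : ℤ) : M ∘ₗ T.G k = T₁.G k ∘ₗ M := tw.hom_ext fun v s => by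
    simp only [LinearMap.comp_apply, tw.actG_s19, map_add, M]
    induction s using NSMod.graded_induction with
    | even s hs =>
      simp only [TensorWitness.twistedMap_t_even _ hs, tw₁.actG_s19, g.commG, gS.commG,
        TensorWitness.twistedMap_t_odd _ (S.mapsG_even k s hs), NSMod.parity_parity]
    | odd s hs =>
      simp only [TensorWitness.twistedMap_t_odd _ hs, tw₁.actG_s19, g.commG, gS.commG,
        TensorWitness.twistedMap_t_even _ (S.mapsG_odd k s hs), NSMod.parity_G, map_neg,
        NSMod.parity_parity, neg_neg]
    | add s s' hs hs' =>
      simp only [map_add]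
      linear_combination (norm := module) hs + hs'
  exact ⟨⟨M, fun m => LinearMap.congr_fun (hL m), fun k => LinearMap.congr_fun (hG k)⟩,
    TensorWitness.twistedMap_bijective hg hgS⟩

end FactorsIso

/-- Theorem 4.2: for highest weight modules `V`, `V₁`
(not necessarily simple) of highest weights `(c,h)`, `(c₁,h₁)` and
intermediate series modules `SA'_{a,b}`, `SA'_{a₁,b₁}` (with
`0 ≤ Re a, Re a₁ < 1`, `b, b₁ ≠ 1`), one has
`V ⊗ SA'_{a,b} ≅ V₁ ⊗ SA'_{a₁,b₁}` if and only if `V ≅ V₁` and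
`SA'_{a,b} ≅ SA'_{a₁,b₁}`. -/
theorem tensor_iso_iff_factors_iso (a b c h a₁ b₁ c₁ h₁ : ℂ)
    (ha0 : 0 ≤ a.re) (ha1 : a.re < 1) (hb : b ≠ 1)
    (ha₁0 : 0 ≤ a₁.re) (ha₁1 : a₁.re < 1) (hb₁ : b₁ ≠ 1)
    (V : NSMod c) (u : V.carrier) (hV : IsHW h V u)
    (V₁ : NSMod c₁) (u₁ : V₁.carrier) (hV₁ : IsHW h₁ V₁ u₁)
    (S : NSMod 0) (F : SA'Family a b S)
    (S₁ : NSMod 0) (F₁ : SA'Family a₁ b₁ S₁)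
    (T : NSMod c) (tw : TensorWitness V S T)
    (T₁ : NSMod c₁) (tw₁ : TensorWitness V₁ S₁ T₁) :
    NSIso T T₁ ↔ (NSIso V V₁ ∧ NSIso S S₁) :=
  ⟨factors_iso_of_tensor_iso ha0 ha1 hb ha₁0 ha₁1 hb₁ hV hV₁ F F₁ tw tw₁,
    fun hVS => tensor_iso_of_factors_iso tw tw₁ hVS.1 hVS.2⟩
end
end
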